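/- arXiv:1804.06684 — 3 statements merged into one kernel-verified Lean document; each statement's English description precedes it below -/
import Mathlib

section
/- Let G be a finite group such that every non-cyclic subgroup H of G (including G itself, if G is non-cyclic) has an ES-partition for some subgroup S of H. Then G is nilpotent. -/
/-- A strict `S`-partition of a group `G`: a finite collection of at least two proper
subgroups of `G` covering `G`, any two distinct members of which intersect exactly in `S`. -/
def IsStrictPartition {G : Type*} [Group G] (S : Subgroup G) (P : Finset (Subgroup G)) : Prop :=
  2 ≤ P.card ∧ (∀ H ∈ P, H ≠ ⊤) ∧ (∀ g : G, ∃ H ∈ P, g ∈ H) ∧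
    ∀ H ∈ P, ∀ K ∈ P, H ≠ K → H ⊓ K = S

/-- An `ES`-partition: a strict `S`-partition all of whose components have the same order. -/
def IsESPartition {G : Type*} [Group G] (S : Subgroup G) (P : Finset (Subgroup G)) : Prop :=
  IsStrictPartition S P ∧ ∀ H ∈ P, ∀ K ∈ P, Nat.card H = Nat.card K

open scoped Pointwise

/-- If `H` contains a Sylow `p`-subgroup of `G` for every prime `p`, then `H = G`. -/
theorem Subgroup.eq_top_of_forall_sylow_le {G : Type*} [Group G] [Finite G] (H : Subgroup G)
    (h : ∀ p : ℕ, p.Prime → ∃ P : Sylow p G, (P : Subgroup G) ≤ H) : H = ⊤ := by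
  by_contra hH
  obtain ⟨p, hp, hpH⟩ := Nat.exists_prime_and_dvd (mt Subgroup.index_eq_one.mp hH)
  have : Fact p.Prime := ⟨hp⟩
  obtain ⟨P, hP⟩ := h p hp
  exact P.not_dvd_index (hpH.trans (Subgroup.index_dvd_of_le hP))

/-- If `K` has full `p`-part, then a Sylow `p`-subgroup of `K` is one of `G`. -/
theorem Sylow.exists_coe_eq_map_subtype {G : Type*} [Group G] [Finite G] {p : ℕ} [Fact p.Prime]
    {K : Subgroup G} (hK : (Nat.card K).factorization p = (Nat.card G).factorization p)
    (R : Sylow p K) : ∃ P : Sylow p G, (P : Subgroup G) = (R : Subgroup K).map K.subtype :=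
  ⟨Sylow.ofCard _ (by
    rw [Subgroup.card_map_of_injective K.subtype_injective, R.card_eq_multiplicity, hK]),
    Sylow.coe_ofCard _ _⟩

/-- Commuting of coprime Sylow subgroups inside a nilpotent subgroup. -/
theorem Sylow.commute_of_mem_nilpotent {G : Type*} [Group G] [Finite G] {p q : ℕ} [Fact p.Prime]
    [Fact q.Prime] (hpq : p ≠ q) (P : Sylow p G) (Q : Sylow q G) (K : Subgroup G)
    [Group.IsNilpotent K] {x y : G} (hxP : x ∈ P) (hyQ : y ∈ Q) (hxK : x ∈ K) (hyK : y ∈ K) :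
    Commute x y := by
  obtain ⟨X, hX⟩ := (P.isPGroup'.comap_of_injective K.subtype K.subtype_injective).exists_le_sylow
  obtain ⟨Y, hY⟩ := (Q.isPGroup'.comap_of_injective K.subtype K.subtype_injective).exists_le_sylow
  have hc := Subgroup.commute_of_normal_of_disjoint (X : Subgroup K) Y inferInstance inferInstance
    (IsPGroup.disjoint_of_ne p q hpq _ _ X.isPGroup' Y.isPGroup') ⟨x, hxK⟩ ⟨y, hyK⟩
    (hX hxP) (hY hyQ)
  exact congrArg Subtype.val hc.eq

/-- The nontrivial elements of the union of the conjugates of `M`. -/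
def Subgroup.nontrivialConjugates {G : Type*} [Group G] (M : Subgroup G) : Set G :=
  {x | x ≠ 1 ∧ ∃ g : G, g⁻¹ * x * g ∈ M}

namespace Subgroup

variable {G : Type*} [Group G]

theorem card_quotient_prod_add_index [Finite G] (M : Subgroup G) :
    Nat.card ((G ⧸ M) × {m : M // m ≠ 1}) + M.index = Nat.card G := by
  have h1 : Nat.card {m : M // m ≠ 1} + 1 = Nat.card M := by
    have := Set.ncard_add_ncard_compl ({1} : Set M)
    rw [Set.ncard_singleton, add_comm] at this
    exact this
  rw [Nat.card_prod, ← M.index_mul_card, ← h1, mul_add, mul_one]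
  rfl

/-- Sends `(gM, m)` to the conjugate of `m` by the chosen representative of `gM`. -/
noncomputable def conjOut (M : Subgroup G) (a : (G ⧸ M) × {m : M // m ≠ 1}) :
    M.nontrivialConjugates :=
  ⟨a.1.out * a.2.1 * a.1.out⁻¹, by
    refine ⟨?_, a.1.out, ?_⟩
    · rw [Ne, conj_eq_one_iff]
      simpa using a.2.2
    · simp [mul_assoc]⟩

theorem conjOut_surjective (M : Subgroup G) : Function.Surjective M.conjOut := by
  rintro ⟨x, hx1, g, hg⟩
  obtain ⟨m, hm⟩ := QuotientGroup.mk_out_eq_mul M g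
  refine ⟨((g : G ⧸ M), ⟨⟨(m : G)⁻¹ * (g⁻¹ * x * g) * m,
    M.mul_mem (M.mul_mem (M.inv_mem m.2) hg) m.2⟩, ?_⟩), ?_⟩
  · intro h
    have h' := congrArg Subtype.val h
    apply hx1
    simp only [OneMemClass.coe_one] at h'
    have : x = (g * m) * ((m : G)⁻¹ * (g⁻¹ * x * g) * m) * (g * m)⁻¹ := by group
    rw [this, h']
    simp
  · apply Subtype.ext
    simp only [conjOut, hm]
    group

theorem ncard_nontrivialConjugates_add_index_le [Finite G] (M : Subgroup G) :
    M.nontrivialConjugates.ncard + M.index ≤ Nat.card G := by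
  rw [← M.card_quotient_prod_add_index]
  exact Nat.add_le_add_right (Nat.card_le_card_of_surjective _ M.conjOut_surjective) _

theorem exists_notMem_nontrivialConjugates [Finite G] {M : Subgroup G} (hM : M ≠ ⊤) :
    ∃ g : G, g ≠ 1 ∧ g ∉ M.nontrivialConjugates := by
  by_contra! h
  have h1 : ({1}ᶜ : Set G).ncard ≤ M.nontrivialConjugates.ncard := Set.ncard_le_ncard h
  have h2 := Set.ncard_add_ncard_compl ({1} : Set G)
  rw [Set.ncard_singleton] at h2
  have h3 := M.ncard_nontrivialConjugates_add_index_le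
  have h4 := M.one_lt_index_of_ne_top hM
  omega

theorem conjOut_injective {M : Subgroup G} (hM : normalizer (M : Set G) = M)
    (hd : ∀ g : G, MulAut.conj g • M ≠ M → Disjoint (MulAut.conj g • M) M) :
    Function.Injective M.conjOut := by
  rintro ⟨a, ⟨m, hm⟩⟩ ⟨b, ⟨n, hn⟩⟩ hab
  have hab : a.out * m * a.out⁻¹ = b.out * n * b.out⁻¹ := congrArg Subtype.val hab
  have hmem : a.out⁻¹ * b.out ∈ M := by
    by_contra hc
    have hne : MulAut.conj (a.out⁻¹ * b.out) • M ≠ M := by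
      intro he
      refine hc (hM.le fun x ↦ ?_)
      nth_rw 2 [← he]
      simp [Set.mem_smul_set_iff_inv_smul_mem, ← map_inv, mul_assoc]
    have h1 : (m : G) ∈ MulAut.conj (a.out⁻¹ * b.out) • M := by
      rw [mem_pointwise_smul_iff_inv_smul_mem]
      have : (MulAut.conj (a.out⁻¹ * b.out))⁻¹ • (m : G) = n := by
        rw [← map_inv, MulAut.smul_def, MulAut.conj_apply]
        calc _ = b.out⁻¹ * (a.out * m * a.out⁻¹) * b.out := by group
          _ = n := by rw [hab]; group
      rw [this]
      exact n.2
    exact hm (Subtype.ext (disjoint_def.mp (hd _ hne) h1 m.2))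
  have hq : a = b := by
    rw [← a.out_eq', ← b.out_eq']
    exact QuotientGroup.eq.mpr hmem
  subst hq
  have : m = n := Subtype.ext (by simpa using hab)
  subst this
  rfl

theorem isCoatom_conj_smul {M : Subgroup G} (hM : IsCoatom M) (g : G) :
    IsCoatom (MulAut.conj g • M) :=
  ((MulAut.conj g).mapSubgroup.isCoatom_iff M).mpr hM

end Subgroup

open Subgroup in
/-- A finite noncyclic simple group has two distinct maximal subgroups meeting nontrivially. -/
theorem IsSimpleGroup.exists_isCoatom_not_disjoint {G : Type*} [Group G] [Finite G]
    [IsSimpleGroup G] (hG : ¬ IsCyclic G) :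
    ∃ M N : Subgroup G, IsCoatom M ∧ IsCoatom N ∧ M ≠ N ∧ ¬ Disjoint M N := by
  by_contra! hd
  have hex (g : G) : ∃ M : Subgroup G, IsCoatom M ∧ g ∈ M := by
    rcases eq_top_or_exists_le_coatom (zpowers g) with h | ⟨M, hM, hgM⟩
    · exact (hG ⟨g, fun x ↦ h.ge (mem_top x)⟩).elim
    · exact ⟨M, hM, hgM (mem_zpowers g)⟩
  have hbot {M : Subgroup G} (hM : IsCoatom M) : M ≠ ⊥ := by
    rintro rfl
    obtain ⟨g, hg⟩ := exists_ne (1 : G)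
    obtain ⟨N, hN, hgN⟩ := hex g
    rcases hM.le_iff.mp (bot_le (a := N)) with h | h
    · exact hN.1 h
    · exact hg (by simpa [h] using hgN)
  have hnorm {M : Subgroup G} (hM : IsCoatom M) : normalizer (M : Set G) = M := by
    rcases hM.le_iff.mp (le_normalizer (H := M)) with h | h
    · rcases (normalizer_eq_top_iff.mp h).eq_bot_or_eq_top with h | h
      · exact (hbot hM h).elim
      · exact (hM.1 h).elim
    · exact h
  have hcard {M : Subgroup G} (hM : IsCoatom M) :
      Nat.card G ≤ 2 * M.nontrivialConjugates.ncard := by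
    have h1 : Nat.card ((G ⧸ M) × {m : M // m ≠ 1}) ≤ M.nontrivialConjugates.ncard :=
      Nat.card_le_card_of_injective _ (conjOut_injective (hnorm hM)
        fun g hg ↦ hd _ _ (isCoatom_conj_smul hM g) hM hg)
    have h2 := M.card_quotient_prod_add_index
    have h3 := M.index_mul_card
    have h4 : 2 ≤ Nat.card M := M.one_lt_card_iff_ne_bot.mpr (hbot hM)
    nlinarith
  obtain ⟨M, hM, -⟩ := hex 1
  obtain ⟨g, hg1, hgM⟩ := exists_notMem_nontrivialConjugates hM.1
  obtain ⟨N, hN, hgN⟩ := hex g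
  have hdisj : Disjoint M.nontrivialConjugates N.nontrivialConjugates := by
    rw [Set.disjoint_left]
    rintro x ⟨hx1, a, ha⟩ ⟨-, b, hb⟩
    have ha' : x ∈ MulAut.conj a • M := by
      rw [mem_pointwise_smul_iff_inv_smul_mem]
      simpa [← map_inv] using ha
    have hb' : x ∈ MulAut.conj b • N := by
      rw [mem_pointwise_smul_iff_inv_smul_mem]
      simpa [← map_inv] using hb
    by_cases he : MulAut.conj a • M = MulAut.conj b • N
    · apply hgM
      refine ⟨hg1, b⁻¹ * a, ?_⟩
      have : MulAut.conj b • g ∈ MulAut.conj a • M := by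
        rw [he]
        exact smul_mem_pointwise_smul _ _ _ hgN
      rw [mem_pointwise_smul_iff_inv_smul_mem] at this
      simpa [← map_inv, mul_assoc] using this
    · exact hx1 (disjoint_def.mp
        (hd _ _ (isCoatom_conj_smul hM a) (isCoatom_conj_smul hN b) he) ha' hb')
  have hle : (M.nontrivialConjugates ∪ N.nontrivialConjugates).ncard ≤ ({1}ᶜ : Set G).ncard :=
    Set.ncard_le_ncard (Set.union_subset (fun x hx ↦ hx.1) fun x hx ↦ hx.1)
  rw [Set.ncard_union_eq hdisj] at hle
  have h2 := Set.ncard_add_ncard_compl ({1} : Set G)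
  rw [Set.ncard_singleton] at h2
  have h3 := hcard hM
  have h4 := hcard hN
  omega

open Subgroup in
/-- In a nilpotent subgroup `M`, proper subgroups are properly contained in their normalizers. -/
theorem Subgroup.lt_inf_normalizer_of_isNilpotent {G : Type*} [Group G] {D M : Subgroup G}
    [Group.IsNilpotent M] (h : D < M) : D < M ⊓ normalizer (D : Set G) := by
  refine lt_of_le_of_ne (le_inf h.le le_normalizer) fun he ↦ ?_
  have hlt : D.subgroupOf M < ⊤ := by
    rw [lt_top_iff_ne_top, Ne, subgroupOf_eq_top]
    exact h.not_ge
  refine (Group.normalizerCondition_of_isNilpotent (G := M) _ hlt).not_ge ?_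
  rw [← subgroupOf_normalizer_eq h.le]
  intro x hx
  rw [mem_subgroupOf, he]
  exact ⟨x.2, hx⟩

open Subgroup in
/-- A finite simple group all of whose proper subgroups are nilpotent is cyclic. -/
theorem IsSimpleGroup.isCyclic_of_forall_isNilpotent {G : Type*} [Group G] [Finite G]
    [IsSimpleGroup G] (h : ∀ H : Subgroup G, H ≠ ⊤ → Group.IsNilpotent H) : IsCyclic G := by
  by_contra hG
  let T : Set (Subgroup G) :=
    {D | ∃ M N : Subgroup G, IsCoatom M ∧ IsCoatom N ∧ M ≠ N ∧ D = M ⊓ N}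
  obtain ⟨M₀, N₀, hM₀, hN₀, hne₀, hd₀⟩ := exists_isCoatom_not_disjoint hG
  obtain ⟨D, hD₀, hD⟩ := (Set.toFinite T).exists_le_maximal ⟨M₀, N₀, hM₀, hN₀, hne₀, rfl⟩
  obtain ⟨M, N, hM, hN, hne, rfl⟩ := hD.prop
  have hbot : M ⊓ N ≠ ⊥ := fun he ↦ hd₀ (disjoint_iff.mpr (le_bot_iff.mp (he ▸ hD₀)))
  have key {A B : Subgroup G} (hA : IsCoatom A) (hB : IsCoatom B) (hAB : M ⊓ N < A)
      (hle : normalizer ((M ⊓ N : Subgroup G) : Set G) ≤ B) : A = B := by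
    by_contra hAB'
    have := h A hA.1
    have hlt : M ⊓ N < A ⊓ B :=
      (lt_inf_normalizer_of_isNilpotent hAB).trans_le (inf_le_inf_left A hle)
    exact hlt.not_ge (hD.le_of_ge ⟨A, B, hA, hB, hAB', rfl⟩ hlt.le)
  rcases eq_top_or_exists_le_coatom (normalizer ((M ⊓ N : Subgroup G) : Set G))
    with he | ⟨B, hB, hle⟩
  · rcases (normalizer_eq_top_iff.mp he).eq_bot_or_eq_top with he | he
    · exact hbot he
    · exact hM.1 (top_le_iff.mp (he ▸ inf_le_left))
  · have hMN : ¬ M ≤ N := fun hle ↦ (hM.le_iff.mp hle).elim hN.1 (fun e ↦ hne e.symm)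
    have hNM : ¬ N ≤ M := fun hle ↦ (hN.le_iff.mp hle).elim hM.1 hne
    exact hne ((key hM hB (inf_lt_left.mpr hMN) hle).trans
      (key hN hB (inf_lt_right.mpr hNM) hle).symm)

/-- A nontrivial finite group whose proper subgroups are nilpotent has a normal subgroup of prime
index. -/
theorem Group.exists_normal_prime_index {G : Type*} [Group G] [Finite G] [Nontrivial G]
    (h : ∀ H : Subgroup G, H ≠ ⊤ → Group.IsNilpotent H) :
    ∃ D : Subgroup G, D.Normal ∧ D.index.Prime := by
  obtain ⟨D, -, hD⟩ := (Set.toFinite {D : Subgroup G | D.Normal ∧ D ≠ ⊤}).exists_le_maximal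
    ⟨(inferInstance : (⊥ : Subgroup G).Normal), bot_ne_top⟩
  have := hD.prop.1
  have hsurj := QuotientGroup.mk'_surjective D
  have : Nontrivial (G ⧸ D) := QuotientGroup.nontrivial_iff.mpr hD.prop.2
  have : IsSimpleGroup (G ⧸ D) := ⟨fun K hK ↦ by
    by_cases hK' : K = ⊤
    · exact Or.inr hK'
    · left
      have hne : K.comap (QuotientGroup.mk' D) ≠ ⊤ := fun he ↦
        hK' (Subgroup.comap_injective hsurj (by rw [he, Subgroup.comap_top]))
      have hle : D ≤ K.comap (QuotientGroup.mk' D) := QuotientGroup.le_comap_mk' D K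
      have := hD.le_of_ge ⟨hK.comap _, hne⟩ hle
      rw [eq_bot_iff, ← Subgroup.map_comap_eq_self_of_surjective hsurj K]
      exact (Subgroup.map_mono this).trans (by rw [QuotientGroup.map_mk'_self])⟩
  have hcyc : IsCyclic (G ⧸ D) := IsSimpleGroup.isCyclic_of_forall_isNilpotent fun K hK ↦ by
    have := h (K.comap (QuotientGroup.mk' D)) fun he ↦
      hK (Subgroup.comap_injective hsurj (by rw [he, Subgroup.comap_top]))
    exact Group.nilpotent_of_surjective ((QuotientGroup.mk' D).subgroupComap K)
      ((QuotientGroup.mk' D).subgroupComap_surjective_of_surjective K hsurj)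
  refine ⟨D, inferInstance, ?_⟩
  let : CommGroup (G ⧸ D) := IsCyclic.commGroup
  exact IsSimpleGroup.prime_card

/-- A finite non-nilpotent group whose proper subgroups are nilpotent has a cyclic Sylow subgroup
that is not normal. -/
theorem Group.exists_isCyclic_sylow_not_normal {G : Type*} [Group G] [Finite G]
    (hG : ¬ Group.IsNilpotent G) (h : ∀ H : Subgroup G, H ≠ ⊤ → Group.IsNilpotent H) :
    ∃ q : ℕ, ∃ _ : Fact q.Prime, ∃ Q : Sylow q G, IsCyclic Q ∧ ¬ (Q : Subgroup G).Normal := by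
  have : Nontrivial G := by
    by_contra hn
    rw [not_nontrivial_iff_subsingleton] at hn
    exact hG inferInstance
  obtain ⟨D, hDn, hDq⟩ := Group.exists_normal_prime_index h
  have := h D (fun he ↦ hDq.ne_one (Subgroup.index_eq_one.mpr he))
  have hnormal (p : ℕ) [Fact p.Prime] (hpq : p ≠ D.index) (P : Sylow p G) :
      (P : Subgroup G).Normal := by
    have hp := Fact.out (p := p.Prime)
    obtain ⟨R⟩ : Nonempty (Sylow p D) := inferInstance
    obtain ⟨P', hP'⟩ := R.exists_coe_eq_map_subtype (by
      rw [← D.card_mul_index, Nat.factorization_mul Nat.card_pos.ne' hDq.ne_zero]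
      simp [Nat.factorization_eq_zero_of_not_dvd (mt (Nat.prime_dvd_prime_iff_eq hp hDq).mp hpq)])
    have : (R : Subgroup D).Characteristic := R.characteristic_of_normal inferInstance
    have hn : (P' : Subgroup G).Normal := hP' ▸ inferInstance
    have := P'.unique_of_normal hn
    rwa [Subsingleton.elim P P']
  have : Fact D.index.Prime := ⟨hDq⟩
  obtain ⟨Q, hQ⟩ : ∃ Q : Sylow D.index G, ¬ (Q : Subgroup G).Normal := by
    by_contra! hc
    refine hG (((Group.isNilpotent_of_finite_tfae (G := G)).out 0 3).mpr ?_)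
    intro p _ P
    by_cases hp : p = D.index
    · subst hp
      exact hc P
    · exact hnormal p hp P
  refine ⟨D.index, this, Q, ?_, hQ⟩
  by_contra hcyc
  refine hQ (Subgroup.normalizer_eq_top_iff.mp (Subgroup.eq_top_of_forall_sylow_le _ fun p hp ↦ ?_))
  have : Fact p.Prime := ⟨hp⟩
  by_cases hpq : p = D.index
  · subst hpq
    exact ⟨Q, Subgroup.le_normalizer⟩
  obtain ⟨P⟩ : Nonempty (Sylow p G) := inferInstance
  refine ⟨P, fun x hx ↦ Subgroup.centralizer_le_normalizer _ fun y hy ↦ ?_⟩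
  have hPn := hnormal p hpq P
  have hK : (P : Subgroup G) ⊔ Subgroup.zpowers y ≠ ⊤ := by
    intro htop
    refine hcyc ⟨⟨y, hy⟩, fun z ↦ ?_⟩
    obtain ⟨a, ha, b, hb, hab⟩ := Subgroup.mem_sup_of_normal_left.mp
      (htop ▸ Subgroup.mem_top (z : G))
    have hbQ : b ∈ (Q : Subgroup G) := Subgroup.zpowers_le.mpr hy hb
    have haQ : a ∈ (Q : Subgroup G) := by
      rw [eq_mul_inv_of_mul_eq hab]
      exact mul_mem z.2 (inv_mem hbQ)
    have ha1 : a = 1 := Subgroup.disjoint_def.mp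
      (IsPGroup.disjoint_of_ne p _ hpq _ _ P.isPGroup' Q.isPGroup') ha haQ
    rw [ha1, one_mul] at hab
    obtain ⟨k, hk⟩ := hb
    exact ⟨k, Subtype.ext (by simpa [← hab] using hk)⟩
  have := h _ hK
  exact (P.commute_of_mem_nilpotent hpq Q (↑P ⊔ Subgroup.zpowers y) hx hy
    (le_sup_left (a := (P : Subgroup G)) hx)
    (le_sup_right (a := (P : Subgroup G)) (Subgroup.mem_zpowers y))).symm.eq

/-- If a finite group is covered by nilpotent subgroups of equal order, then its cyclic Sylow
subgroups are normal. -/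
theorem Sylow.normal_of_isCyclic_of_cover {G : Type*} [Group G] [Finite G]
    {P : Set (Subgroup G)} (hnil : ∀ H ∈ P, Group.IsNilpotent H)
    (hcover : ∀ g : G, ∃ H ∈ P, g ∈ H) (hcard : ∀ H ∈ P, ∀ K ∈ P, Nat.card H = Nat.card K)
    {q : ℕ} [Fact q.Prime] (Q : Sylow q G) [IsCyclic Q] : (Q : Subgroup G).Normal := by
  obtain ⟨y, hy⟩ := IsCyclic.exists_generator (α := Q)
  obtain ⟨H, hHP, hyH⟩ := hcover y
  have hQH : (Q : Subgroup G) ≤ H := by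
    intro z hz
    obtain ⟨k, hk⟩ := hy ⟨z, hz⟩
    have : (y : G) ^ k = z := congrArg Subtype.val hk
    exact this ▸ zpow_mem hyH k
  have hfact : (Nat.card H).factorization q = (Nat.card G).factorization q := by
    refine le_antisymm ((Nat.factorization_le_iff_dvd Nat.card_pos.ne' Nat.card_pos.ne').mpr
      H.card_subgroup_dvd_card q) ?_
    rw [← (Fact.out (p := q.Prime)).pow_dvd_iff_le_factorization Nat.card_pos.ne',
      ← Q.card_eq_multiplicity]
    exact Subgroup.card_dvd_of_le hQH
  refine Subgroup.normalizer_eq_top_iff.mp ?_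
  by_contra hne
  obtain ⟨g, hg1, hg⟩ := Subgroup.exists_notMem_nontrivialConjugates hne
  obtain ⟨K, hKP, hgK⟩ := hcover g
  have := hnil K hKP
  obtain ⟨R⟩ : Nonempty (Sylow q K) := inferInstance
  obtain ⟨Q', hQ'⟩ := R.exists_coe_eq_map_subtype (hcard H hHP K hKP ▸ hfact)
  have hgQ' : g • Q' = Q' := by
    rw [Sylow.smul_eq_iff_mem_normalizer, ← Sylow.coe_coe, hQ']
    exact Subgroup.le_normalizer_map _ 
      ⟨⟨g, hgK⟩, (Subgroup.normalizer_eq_top_iff.mpr inferInstance).ge (Subgroup.mem_top _), rfl⟩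
  obtain ⟨x, rfl⟩ := MulAction.exists_smul_eq G Q Q'
  refine hg ⟨hg1, x, ?_⟩
  rw [Sylow.coe_coe, ← Sylow.smul_eq_iff_mem_normalizer, mul_smul, mul_smul, hgQ', inv_smul_smul]

/-- A finite group with an `ES`-partition whose proper subgroups are nilpotent is nilpotent. -/
theorem IsESPartition.isNilpotent {G : Type*} [Group G] [Finite G] {S : Subgroup G}
    {P : Finset (Subgroup G)} (hP : IsESPartition S P)
    (h : ∀ H : Subgroup G, H ≠ ⊤ → Group.IsNilpotent H) : Group.IsNilpotent G := by
  by_contra hG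
  obtain ⟨q, _, Q, _, hQ⟩ := Group.exists_isCyclic_sylow_not_normal hG h
  obtain ⟨⟨-, hproper, hcover, -⟩, hcard⟩ := hP
  exact hQ (Q.normal_of_isCyclic_of_cover (P := (P : Set (Subgroup G)))
    (fun H hH ↦ h H (hproper H hH)) hcover hcard)

theorem nilpotent_of_forall_ESPartition {G : Type*} [Group G] [Finite G]
    (h : ∀ H : Subgroup G, ¬ IsCyclic H →
      ∃ (S : Subgroup H) (P : Finset (Subgroup H)), IsESPartition S P) :
    Group.IsNilpotent G := by
  suffices key : ∀ H : Subgroup G, Group.IsNilpotent H from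
    Group.isNilpotent_top.mp (key ⊤)
  intro H
  induction H using WellFoundedLT.induction with
  | ind H ih =>
    by_cases hH : IsCyclic H
    · let : CommGroup H := IsCyclic.commGroup
      infer_instance
    · obtain ⟨S, P, hP⟩ := h H hH
      refine hP.isNilpotent fun K hK ↦ ?_
      have := ih (K.map H.subtype) (lt_of_le_of_ne (Subgroup.map_subtype_le K) fun he ↦
        hK (Subgroup.map_injective H.subtype_injective (by
          rw [he, ← MonoidHom.range_eq_map, Subgroup.range_subtype])))
      exact Group.nilpotent_of_mulEquiv
        (K.equivMapOfInjective H.subtype H.subtype_injective).symm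
end

section
/- Let G be a finite non-cyclic group which has an E(Φ(G))-partition, where Φ(G) is the Frattini subgroup of G. Then G is a p-group, i.e. |G| is a power of a single prime p. -/
section OperatorSums

variable {S : Type*} [Ring S]

theorem natCast_mul_sub_one_eq_zero_of_sum_pow {a b : S} {r : ℕ} (hr : r.Prime)
    (hab : Commute a b) (hb : b ^ r = 1)
    (h : ∀ j < r, ∑ i ∈ Finset.range r, (a * b ^ j) ^ i = 0) : (r : S) * (b - 1) = 0 := by
  have h1 : ∑ i ∈ Finset.range r, a ^ i * ∑ j ∈ Finset.range r, (b ^ i) ^ j = 0 := by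
    have h2 : ∑ j ∈ Finset.range r, ∑ i ∈ Finset.range r, (a * b ^ j) ^ i = 0 :=
      Finset.sum_eq_zero fun j hj => h j (Finset.mem_range.1 hj)
    rw [Finset.sum_comm] at h2
    rw [← h2]
    refine Finset.sum_congr rfl fun i _ => ?_
    rw [Finset.mul_sum]
    refine Finset.sum_congr rfl fun j _ => ?_
    rw [(hab.pow_right j).mul_pow, ← pow_mul, ← pow_mul, mul_comm i j]
  have h3 : ∀ i ∈ (Finset.range r).erase 0,
      (a ^ i * ∑ j ∈ Finset.range r, (b ^ i) ^ j) * (b - 1) = 0 := by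
    intro i hi
    rw [Finset.mem_erase, Finset.mem_range] at hi
    have hco : i.Coprime (orderOf b) :=
      Nat.Coprime.coprime_dvd_right (orderOf_dvd_of_pow_eq_one hb)
        (Nat.coprime_of_lt_prime hi.1 hi.2 hr).symm
    obtain ⟨m, hm⟩ := exists_pow_eq_self_of_coprime hco
    have h4 : b - 1 = (b ^ i - 1) * ∑ j ∈ Finset.range m, (b ^ i) ^ j := by
      rw [mul_geom_sum, hm]
    rw [h4, mul_assoc, ← mul_assoc (∑ j ∈ Finset.range r, (b ^ i) ^ j), geom_sum_mul,
      ← pow_mul, mul_comm i r, pow_mul, hb]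
    simp
  rw [← Finset.add_sum_erase _ _ (Finset.mem_range.2 hr.pos)] at h1
  have h5 := congrArg (fun s => s * (b - 1)) h1
  simp only [add_mul, Finset.sum_mul, zero_mul, Finset.sum_eq_zero h3] at h5
  simpa using h5

theorem sum_pow_mul_eq {a : S} {l c : ℕ} (hl : 0 < l) (ha : a ^ l = 1) (hc : c.Coprime l) :
    ∑ k ∈ Finset.range l, (a ^ c) ^ k = ∑ k ∈ Finset.range l, a ^ k := by
  have hmap : ∀ k ∈ Finset.range l, c * k % l ∈ Finset.range l := fun k _ =>
    Finset.mem_range.2 (Nat.mod_lt _ hl)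
  have hinj : Set.InjOn (fun k => c * k % l) (Finset.range l : Set ℕ) := by
    intro x hx y hy hxy
    have h1 : x ≡ y [MOD l] := Nat.ModEq.cancel_left_of_coprime hc.symm hxy
    rw [Finset.coe_range, Set.mem_Iio] at hx hy
    exact Nat.ModEq.eq_of_lt_of_lt h1 hx hy
  refine Finset.sum_nbij (fun k => c * k % l) hmap hinj
    (Finset.surjOn_of_injOn_of_card_le _ hmap hinj le_rfl) fun k _ => ?_
  rw [← pow_mul, pow_eq_pow_mod _ ha]

theorem natCast_eq_zero_of_sum_pow_of_twist {a x : S} {l r : ℕ} (hl : l.Prime) (hr : 0 < r)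
    (ha : a ^ l = 1) (hNa : ∑ k ∈ Finset.range l, a ^ k = 0)
    (hNx : ∑ i ∈ Finset.range r, x ^ i = 0)
    (htw : ∀ i, 0 < i → i < r → ∃ t : ℕ, x ^ i * a = a ^ t * x ^ i ∧ ¬ t ≡ 1 [MOD l]) :
    (l : S) = 0 := by
  have h1 : ∑ i ∈ Finset.range r, ∑ k ∈ Finset.range l, a ^ k * x ^ i * a ^ ((l - 1) * k) = 0 := by
    rw [Finset.sum_comm]
    refine Finset.sum_eq_zero fun k _ => ?_
    rw [← Finset.sum_mul, ← Finset.mul_sum, hNx]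
    simp
  rw [← Finset.add_sum_erase _ _ (Finset.mem_range.2 hr),
    Finset.sum_eq_zero (s := (Finset.range r).erase 0), add_zero] at h1
  · rw [← h1]
    simp only [pow_zero, mul_one, ← pow_add]
    rw [Finset.sum_congr rfl (g := fun _ => (1 : S))]
    · simp
    · intro k _
      have : k + (l - 1) * k = l * k := by
        obtain ⟨m, hm⟩ := Nat.exists_eq_add_of_lt hl.pos
        subst hm; simp; ring
      rw [this, pow_mul, ha, one_pow]
  · intro i hi
    rw [Finset.mem_erase, Finset.mem_range] at hi
    obtain ⟨t, ht, ht1⟩ := htw i (Nat.pos_of_ne_zero hi.1) hi.2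
    have hsc : ∀ m : ℕ, x ^ i * a ^ m = a ^ (t * m) * x ^ i := by
      intro m
      induction m with
      | zero => simp
      | succ m ih =>
        rw [pow_succ, ← mul_assoc, ih, mul_assoc, ht, ← mul_assoc, ← pow_add]; ring_nf
    have hc : (1 + t * (l - 1)).Coprime l := by
      rw [Nat.coprime_comm, hl.coprime_iff_not_dvd]
      intro hd
      apply ht1
      rw [← Int.natCast_modEq_iff]
      have h2 : (l : ℤ) ∣ 1 + t * (l - 1) := by
        have := Int.natCast_dvd_natCast.2 hd
        rwa [Nat.cast_add, Nat.cast_mul, Nat.cast_sub hl.one_le] at this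
      rw [Int.modEq_iff_dvd]
      have h3 : (((1 : ℕ) : ℤ) - t) = (1 + t * (l - 1)) - l * t := by push_cast; ring
      rw [h3]
      exact dvd_sub h2 (dvd_mul_right _ _)
    have h4 : ∀ k ∈ Finset.range l,
        a ^ k * x ^ i * a ^ ((l - 1) * k) = (a ^ (1 + t * (l - 1))) ^ k * x ^ i := by
      intro k _
      rw [mul_assoc, hsc, ← mul_assoc, ← pow_add, ← pow_mul]; ring_nf
    rw [Finset.sum_congr rfl h4, ← Finset.sum_mul, sum_pow_mul_eq hl.pos ha hc, hNa, zero_mul]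

end OperatorSums

section Counting

variable {G : Type*} [Group G]

theorem card_dvd_ncard_of_conj_free {K : Subgroup G} {S : Set G}
    (hS : ∀ k ∈ K, ∀ x ∈ S, k * x * k⁻¹ ∈ S)
    (hf : ∀ k ∈ K, ∀ x ∈ S, Commute k x → k = 1) : Nat.card K ∣ S.ncard := by
  let act : MulAction K S :=
    { smul := fun k x => ⟨k * x * (k : G)⁻¹, hS k k.2 x x.2⟩
      one_smul := fun x => Subtype.ext (by change (1 : G) * x * (1 : G)⁻¹ = x; simp)
      mul_smul := fun k l x => Subtype.ext (by
        change ((k * l : K) : G) * x * ((k * l : K) : G)⁻¹ = k * (l * x * (l : G)⁻¹) * (k : G)⁻¹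
        simp [mul_assoc]) }
  have hst : ∀ x : S, MulAction.stabilizer K x = ⊥ := by
    intro x
    rw [eq_bot_iff]
    intro k hk
    have h1 : (k : G) * x * (k : G)⁻¹ = x := congrArg Subtype.val (MulAction.mem_stabilizer_iff.1 hk)
    exact Subtype.ext (hf k k.2 x x.2 (mul_inv_eq_iff_eq_mul.1 h1))
  have h2 := Nat.card_congr (MulAction.selfEquivOrbitsQuotientProd hst)
  rw [Nat.card_prod] at h2
  rw [← Nat.card_coe_set_eq, h2]
  exact dvd_mul_left _ _

theorem Nat.dvd_of_forall_ordProj_dvd {a b : ℕ} (ha : a ≠ 0)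
    (h : ∀ p : ℕ, p.Prime → p ^ a.factorization p ∣ b) : a ∣ b := by
  rcases eq_or_ne b 0 with rfl | hb
  · exact dvd_zero _
  · rw [← Nat.ordProj_dvd_ordProj_iff_dvd ha hb]
    intro p
    by_cases hp : p.Prime
    · exact (hp.pow_dvd_iff_dvd_ordProj hb).1 (h p hp)
    · simp [Nat.factorization_eq_zero_of_not_prime _ hp]

theorem ncard_eq_sum_of_isStrictPartition [Finite G] {P : Finset (Subgroup G)}
    (hP : IsStrictPartition ⊥ P) {T : Set G} (hT : (1 : G) ∉ T) :
    T.ncard = ∑ H ∈ P, ((H : Set G) ∩ T).ncard := by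
  classical
  have := Fintype.ofFinite G
  have h1 : T = ((P.biUnion fun H => ((H : Set G) ∩ T).toFinset : Finset G) : Set G) := by
    ext x
    simp only [Finset.coe_biUnion, Set.coe_toFinset, Set.mem_iUnion, Set.mem_inter_iff,
      SetLike.mem_coe, exists_prop]
    constructor
    · intro hx
      obtain ⟨H, hH, hxH⟩ := hP.2.2.1 x
      exact ⟨H, hH, hxH, hx⟩
    · rintro ⟨H, -, -, hx⟩
      exact hx
  conv_lhs => rw [h1]
  rw [Set.ncard_coe_finset, Finset.card_biUnion]
  · exact Finset.sum_congr rfl fun H _ => (Set.ncard_eq_toFinset_card' _).symm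
  · intro H hH K hK hHK
    rw [Function.onFun, Finset.disjoint_left]
    intro x hx hx'
    rw [Set.mem_toFinset] at hx hx'
    have h2 : x ∈ H ⊓ K := ⟨hx.1, hx'.1⟩
    rw [hP.2.2.2 H hH K hK hHK, Subgroup.mem_bot] at h2
    exact hT (h2 ▸ hx.2)

theorem ncard_diff_one [Finite G] (H : Subgroup G) :
    ((H : Set G) \ {1}).ncard + 1 = Nat.card H := by
  rw [Set.ncard_sdiff_singleton_add_one H.one_mem, ← Nat.card_coe_set_eq]
  rfl

theorem exists_subgroup_le_card_eq_ordProj [Finite G] (H : Subgroup G) {p : ℕ} (hp : p.Prime) :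
    ∃ K ≤ H, Nat.card K = p ^ (Nat.card H).factorization p := by
  have := Fact.mk hp
  obtain ⟨K, hK⟩ := Sylow.exists_subgroup_card_pow_prime (G := H) p (Nat.ordProj_dvd _ p)
  refine ⟨K.map H.subtype, Subgroup.map_subtype_le K, ?_⟩
  rw [Subgroup.card_map_of_injective H.subtype_injective, hK]

/-- The elements of `q`-power order. -/
def primaryElements (G : Type*) [Group G] (q : ℕ) : Set G := {x | ∃ k : ℕ, x ^ q ^ k = 1}

theorem one_mem_primaryElements (q : ℕ) : (1 : G) ∈ primaryElements G q := ⟨0, by simp⟩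

theorem conj_mem_primaryElements_iff {q : ℕ} {g x : G} :
    g * x * g⁻¹ ∈ primaryElements G q ↔ x ∈ primaryElements G q := by
  simp [primaryElements, conj_pow]

theorem dvd_orderOf_of_mem_primaryElements {q : ℕ} (hq : q.Prime) {x : G}
    (hx : x ∈ primaryElements G q) (hx1 : x ≠ 1) : q ∣ orderOf x := by
  obtain ⟨k, hk⟩ := hx
  obtain ⟨m, -, hm⟩ := (Nat.dvd_prime_pow hq).1 (orderOf_dvd_of_pow_eq_one hk)
  rcases m with - | m
  · rw [pow_zero, orderOf_eq_one_iff] at hm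
    exact absurd hm hx1
  · rw [hm, pow_succ]
    exact dvd_mul_left _ _

theorem mem_primaryElements_of_isPGroup {q : ℕ} {K : Subgroup G} (hK : IsPGroup q K) {x : G}
    (hx : x ∈ K) : x ∈ primaryElements G q := by
  obtain ⟨k, hk⟩ := hK ⟨x, hx⟩
  exact ⟨k, congrArg Subtype.val hk⟩

theorem exists_prime_dvd_orderOf_of_notMem [Finite G] {q : ℕ} {x : G}
    (hx : x ∉ primaryElements G q) : ∃ r : ℕ, r.Prime ∧ r ≠ q ∧ r ∣ orderOf x := by
  by_contra! h
  refine hx ⟨(orderOf x).primeFactorsList.length, ?_⟩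
  rw [← Nat.eq_prime_pow_of_unique_prime_dvd (orderOf_pos x).ne'
    fun {d} hd hdx => by_contra fun hne => h d hd hne hdx, pow_orderOf_eq_one]

/-- Elements of distinct prime orders never commute. -/
def IsEPPO (G : Type*) [Group G] : Prop :=
  ∀ p q : ℕ, p.Prime → q.Prime → p ≠ q → ∀ x y : G, orderOf x = p → orderOf y = q → ¬ Commute x y

theorem IsEPPO.not_commute [Finite G] (hG : IsEPPO G) {p q : ℕ} (hp : p.Prime) (hq : q.Prime)
    (hpq : p ≠ q) {x y : G} (hx : p ∣ orderOf x) (hy : q ∣ orderOf y) : ¬ Commute x y := fun h =>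
  hG p q hp hq hpq _ _ (orderOf_pow_orderOf_div (orderOf_pos x).ne' hx)
    (orderOf_pow_orderOf_div (orderOf_pos y).ne' hy) (h.pow_pow _ _)

theorem IsEPPO.ordProj_dvd_ncard_primaryElements [Finite G] (hG : IsEPPO G) (H : Subgroup G)
    {q r : ℕ} (hq : q.Prime) (hr : r.Prime) (hrq : r ≠ q) :
    r ^ (Nat.card H).factorization r ∣ ((H : Set G) ∩ (primaryElements G q \ {1})).ncard := by
  obtain ⟨K, hKH, hK⟩ := exists_subgroup_le_card_eq_ordProj H hr
  rw [← hK]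
  refine card_dvd_ncard_of_conj_free ?_ ?_
  · rintro k hk x ⟨hxH, hxq, hx1⟩
    exact ⟨H.mul_mem (H.mul_mem (hKH hk) hxH) (H.inv_mem (hKH hk)),
      conj_mem_primaryElements_iff.2 hxq, fun h => hx1 (conj_eq_one_iff.1 h)⟩
  · rintro k hk x ⟨-, hxq, hx1⟩ hkx
    by_contra hk1
    exact hG.not_commute hr hq hrq (dvd_orderOf_of_mem_primaryElements hr
      (mem_primaryElements_of_isPGroup (IsPGroup.of_card hK) hk) hk1)
      (dvd_orderOf_of_mem_primaryElements hq hxq hx1) hkx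

theorem IsEPPO.ordProj_dvd_ncard_diff_primaryElements [Finite G] (hG : IsEPPO G) (H : Subgroup G)
    {q : ℕ} (hq : q.Prime) :
    q ^ (Nat.card H).factorization q ∣ ((H : Set G) \ primaryElements G q).ncard := by
  obtain ⟨K, hKH, hK⟩ := exists_subgroup_le_card_eq_ordProj H hq
  rw [← hK]
  refine card_dvd_ncard_of_conj_free ?_ ?_
  · rintro k hk x ⟨hxH, hxq⟩
    exact ⟨H.mul_mem (H.mul_mem (hKH hk) hxH) (H.inv_mem (hKH hk)),
      fun h => hxq (conj_mem_primaryElements_iff.1 h)⟩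
  · rintro k hk x ⟨-, hxq⟩ hkx
    by_contra hk1
    obtain ⟨r, hr, hrq, hrx⟩ := exists_prime_dvd_orderOf_of_notMem hxq
    exact hG.not_commute hq hr hrq.symm (dvd_orderOf_of_mem_primaryElements hq
      (mem_primaryElements_of_isPGroup (IsPGroup.of_card hK) hk) hk1) hrx hkx

theorem ncard_primaryElements_add_one_add [Finite G] (H : Subgroup G) (q : ℕ) :
    ((H : Set G) ∩ (primaryElements G q \ {1})).ncard + 1 +
      ((H : Set G) \ primaryElements G q).ncard = Nat.card H := by
  have h1 : (1 : G) ∈ (H : Set G) ∩ primaryElements G q :=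
    ⟨H.one_mem, one_mem_primaryElements q⟩
  rw [← Set.inter_sdiff_assoc, Set.ncard_sdiff_singleton_add_one h1,
    Set.ncard_inter_add_ncard_sdiff_eq_ncard,
    ← Nat.card_coe_set_eq]
  rfl

theorem IsEPPO.ncard_primaryElements_eq [Finite G] (hG : IsEPPO G) {H K : Subgroup G}
    (hHK : Nat.card H = Nat.card K) {q : ℕ} (hq : q.Prime) :
    ((H : Set G) ∩ (primaryElements G q \ {1})).ncard =
      ((K : Set G) ∩ (primaryElements G q \ {1})).ncard := by
  wlog hle : ((H : Set G) ∩ (primaryElements G q \ {1})).ncard ≤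
      ((K : Set G) ∩ (primaryElements G q \ {1})).ncard generalizing H K
  · exact (this hHK.symm (le_of_not_ge hle)).symm
  have h1 := ncard_primaryElements_add_one_add H q
  have h2 := ncard_primaryElements_add_one_add K q
  have h3 : Nat.card K ∣ ((K : Set G) ∩ (primaryElements G q \ {1})).ncard -
      ((H : Set G) ∩ (primaryElements G q \ {1})).ncard := by
    refine Nat.dvd_of_forall_ordProj_dvd Nat.card_pos.ne' fun r hr => ?_
    rcases eq_or_ne r q with rfl | hrq
    · have h4 := hG.ordProj_dvd_ncard_diff_primaryElements K hr
      have h5 := hG.ordProj_dvd_ncard_diff_primaryElements H hr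
      rw [hHK] at h5
      have h6 := Nat.dvd_sub h5 h4
      convert h6 using 1
      omega
    · have h4 := hG.ordProj_dvd_ncard_primaryElements K hq hr hrq
      have h5 := hG.ordProj_dvd_ncard_primaryElements H hq hr hrq
      rw [hHK] at h5
      exact Nat.dvd_sub h4 h5
  have h7 := Nat.eq_zero_of_dvd_of_lt h3 (by omega)
  omega

namespace IsESPartition

variable {P : Finset (Subgroup G)}

theorem exists_ne (hP : IsESPartition ⊥ P) (H : Subgroup G) : ∃ K ∈ P, K ≠ H :=
  Finset.exists_mem_ne hP.1.1 H

variable [Finite G]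

theorem card_sub_one (hP : IsESPartition ⊥ P) {H : Subgroup G} (hH : H ∈ P) :
    Nat.card G = P.card * (Nat.card H - 1) + 1 := by
  have h1 := ncard_eq_sum_of_isStrictPartition hP.1 (T := (Set.univ \ {1} : Set G)) (by simp)
  have h2 := ncard_diff_one (⊤ : Subgroup G)
  rw [Subgroup.coe_top, Subgroup.card_top] at h2
  rw [← h2, h1, Finset.sum_const_nat]
  intro K hK
  rw [← hP.2 K hK H hH, ← ncard_diff_one K, ← Set.inter_sdiff_assoc, Set.inter_univ,
    Nat.add_sub_cancel]

theorem two_le_card (hP : IsESPartition ⊥ P) {H : Subgroup G} (hH : H ∈ P) :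
    2 ≤ Nat.card H := by
  by_contra! hlt
  have h1 : Nat.card H = 1 := by have := Nat.card_pos (α := H); omega
  have h2 := hP.card_sub_one hH
  rw [h1] at h2
  exact hP.1.2.1 H hH (Subgroup.eq_top_of_card_eq H (by omega))

theorem sq_card_le (hP : IsESPartition ⊥ P) {H : Subgroup G} (hH : H ∈ P) :
    Nat.card H * Nat.card H ≤ Nat.card G := by
  obtain ⟨K, hK, hKH⟩ := hP.exists_ne H
  have h1 : Disjoint H K := disjoint_iff.2 (hP.1.2.2.2 H hH K hK hKH.symm)
  have h2 := Nat.card_le_card_of_injective _ (Subgroup.mul_injective_of_disjoint h1)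
  rwa [Nat.card_prod, ← hP.2 H hH K hK] at h2

theorem card_lt_mul (hP : IsESPartition ⊥ P) {H : Subgroup G} (hH : H ∈ P) :
    Nat.card G < P.card * Nat.card H := by
  have h1 := hP.card_sub_one hH
  have h2 := hP.two_le_card hH
  have h3 := hP.1.1
  obtain ⟨m, hm⟩ := Nat.exists_eq_add_of_le h2
  rw [hm] at h1 ⊢
  have : 2 + m - 1 = 1 + m := by omega
  rw [this] at h1
  rw [h1]
  nlinarith

theorem coprime_card (hP : IsESPartition ⊥ P) : (Nat.card G).Coprime P.card := by
  obtain ⟨H, hH, -⟩ := hP.exists_ne ⊥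
  rw [hP.card_sub_one hH]
  simp

theorem dvd_card (hP : IsESPartition ⊥ P) {H : Subgroup G} (hH : H ∈ P) {p : ℕ} (hp : p.Prime)
    (hpG : p ∣ Nat.card G) : p ∣ Nat.card H := by
  have := Fact.mk hp
  obtain ⟨x, hx⟩ := exists_prime_orderOf_dvd_card' p hpG
  obtain ⟨K, hK, hxK⟩ := hP.1.2.2.1 x
  rw [hP.2 H hH K hK, ← hx]
  exact Subgroup.orderOf_dvd_natCard _ hxK

/-- No component contains a full Sylow subgroup. -/
theorem not_ordProj_dvd_card (hP : IsESPartition ⊥ P) {H : Subgroup G} (hH : H ∈ P) {p : ℕ}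
    (hp : p.Prime) (hpG : p ∣ Nat.card G) : ¬ p ^ (Nat.card G).factorization p ∣ Nat.card H := by
  intro hdvd
  have := Fact.mk hp
  obtain ⟨z, hz⟩ := exists_prime_orderOf_dvd_card' p hpG
  have hz1 : z ≠ 1 := by
    rintro rfl
    rw [orderOf_one] at hz
    exact hp.one_lt.ne hz
  have hzp : IsPGroup p (Subgroup.zpowers z) :=
    IsPGroup.of_card (n := 1) (by rw [Nat.card_zpowers, hz, pow_one])
  obtain ⟨R, hR⟩ := hzp.exists_le_sylow
  have hex : ∀ K ∈ P, ∃ x : G, x * z * x⁻¹ ∈ K := by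
    intro K hK
    rw [hP.2 H hH K hK] at hdvd
    obtain ⟨L, hL⟩ := Sylow.exists_subgroup_card_pow_prime (G := K) p hdvd
    have hL' : Nat.card (L.map K.subtype) = p ^ (Nat.card G).factorization p := by
      rw [Subgroup.card_map_of_injective K.subtype_injective, hL]
    let T : Sylow p G := Sylow.ofCard (L.map K.subtype) hL'
    obtain ⟨x, hx⟩ := MulAction.exists_smul_eq G R T
    refine ⟨x, Subgroup.map_subtype_le L ?_⟩
    have h1 : x * z * x⁻¹ ∈ ((x • R : Sylow p G) : Subgroup G) := by
      rw [Sylow.coe_subgroup_smul]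
      exact Subgroup.smul_mem_pointwise_smul z (MulAut.conj x) _ (hR (Subgroup.mem_zpowers z))
    rw [hx] at h1
    exact h1
  choose! x hx using hex
  have hinj : Function.Injective
      fun a : (Σ K : P, (K : Subgroup G)) => (a.2 : G) * x (a.1 : Subgroup G) := by
    have key : ∀ a : (Σ K : P, (K : Subgroup G)),
        (a.2 * x a.1) * z * (a.2 * x a.1 : G)⁻¹ ∈ (a.1 : Subgroup G) := by
      rintro ⟨K, k⟩
      have h1 := K.1.mul_mem (K.1.mul_mem k.2 (hx K K.2)) (K.1.inv_mem k.2)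
      simpa [mul_assoc] using h1
    rintro ⟨K, k⟩ ⟨L, l⟩ hkl
    have h1 := key ⟨K, k⟩
    have h2 := key ⟨L, l⟩
    dsimp only at hkl h1 h2
    rw [← hkl] at h2
    have hKL : K = L := by
      by_contra hne
      have h3 : k * x K * z * (k * x K : G)⁻¹ ∈ (K : Subgroup G) ⊓ L := ⟨h1, h2⟩
      rw [hP.1.2.2.2 K K.2 L L.2 fun h => hne (Subtype.ext h), Subgroup.mem_bot,
        conj_eq_one_iff] at h3
      exact hz1 h3
    subst hKL
    rw [Sigma.mk.injEq]
    exact ⟨rfl, heq_of_eq (Subtype.ext (mul_right_cancel hkl))⟩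
  have hle := Nat.card_le_card_of_injective _ hinj
  rw [Nat.card_sigma, Finset.sum_congr rfl fun (K : P) _ => hP.2 K K.2 H hH,
    Finset.sum_const] at hle
  have h3 := hP.card_lt_mul hH
  simp at hle
  omega

theorem card_lt_ordProj_mul (hP : IsESPartition ⊥ P) (hG : IsEPPO G) {H : Subgroup G}
    (hH : H ∈ P) {q : ℕ} (hq : q.Prime) (hqG : q ∣ Nat.card G) :
    Nat.card G < q ^ (Nat.card G).factorization q * Nat.card H := by
  have h1 := ncard_eq_sum_of_isStrictPartition hP.1 (T := primaryElements G q \ {1}) (by simp)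
  rw [Finset.sum_congr rfl fun K hK => hG.ncard_primaryElements_eq (hP.2 K hK H hH) hq,
    Finset.sum_const, smul_eq_mul] at h1
  have h2 := ncard_primaryElements_add_one_add H q
  set N := ((H : Set G) ∩ (primaryElements G q \ {1})).ncard with hN
  have hN0 : 0 < N := by
    rw [Set.ncard_pos]
    have := Fact.mk hq
    obtain ⟨x, hx⟩ := exists_prime_orderOf_dvd_card' q (hP.dvd_card hH hq hqG)
    refine ⟨x, x.2, ⟨1, ?_⟩, ?_⟩
    · rw [pow_one, ← hx, ← Subgroup.orderOf_coe, pow_orderOf_eq_one]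
    · intro h
      rw [Set.mem_singleton_iff, ← orderOf_eq_one_iff, Subgroup.orderOf_coe, hx] at h
      exact hq.one_lt.ne' h
  have h3 : Nat.card G ∣ q ^ (Nat.card G).factorization q * N := by
    refine Nat.dvd_of_forall_ordProj_dvd Nat.card_pos.ne' fun r hr => ?_
    rcases eq_or_ne r q with rfl | hrq
    · exact dvd_mul_right _ _
    · refine dvd_mul_of_dvd_right ?_ _
      have h4 := hG.ordProj_dvd_ncard_primaryElements ⊤ hq hr hrq
      rw [Subgroup.card_top, Subgroup.coe_top, Set.univ_inter, h1] at h4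
      exact (hP.coprime_card.coprime_dvd_left (Nat.ordProj_dvd _ r)).dvd_of_dvd_mul_left h4
  have hq0 : 0 < q ^ (Nat.card G).factorization q := pow_pos hq.pos _
  refine (Nat.le_of_dvd (Nat.mul_pos hq0 hN0) h3).trans_lt ?_
  exact Nat.mul_lt_mul_of_pos_left (by omega) hq0

theorem exists_isPGroup_of_isEPPO (hP : IsESPartition ⊥ P) (hG : IsEPPO G) :
    ∃ p : ℕ, p.Prime ∧ IsPGroup p G := by
  obtain ⟨H, hH, -⟩ := hP.exists_ne ⊥
  have h1 := hP.sq_card_le hH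
  have h2 := hP.two_le_card hH
  obtain ⟨p, hp, hpG⟩ := Nat.exists_prime_and_dvd (n := Nat.card G) (by nlinarith)
  refine ⟨p, hp, IsPGroup.of_card (n := (Nat.card G).primeFactorsList.length)
    (Nat.eq_prime_pow_of_unique_prime_dvd Nat.card_pos.ne' fun {q} hq hqG => ?_)⟩
  by_contra hqp
  have h3 := hP.card_lt_ordProj_mul hG hH hp hpG
  have h4 := hP.card_lt_ordProj_mul hG hH hq hqG
  have h5 : q ^ (Nat.card G).factorization q * p ^ (Nat.card G).factorization p ∣ Nat.card G :=
    Nat.Coprime.mul_dvd_of_dvd_of_dvd (Nat.coprime_pow_primes _ _ hq hp hqp)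
      (Nat.ordProj_dvd _ q) (Nat.ordProj_dvd _ p)
  have h6 := Nat.le_of_dvd Nat.card_pos h5
  have h7 := Nat.mul_lt_mul'' h4 h3
  have h8 := Nat.mul_le_mul h6 h1
  nlinarith

end IsESPartition
end Counting

section Extension

variable {X Q : Type*} [Group X] [Group Q]

/-- The properties, used below, of the quotient map `N(W) → N(W) / W` for a trivial-intersection
subgroup `W` arising from a partition. -/
structure IsTIQuotient (f : X →* Q) : Prop where
  pow_eq_one : ∀ (y : X) (k : ℕ), f y ≠ 1 → f (y ^ k) = 1 → y ^ k = 1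
  exists_prime : ∀ y w : X, f y ≠ 1 → f w = 1 → w ≠ 1 → Commute y w →
    ∃ r : ℕ, r.Prime ∧ y ^ r = 1 ∧ w ^ r = 1
  commute_of_pow : ∀ (w c : X) (k : ℕ), f w ≠ 1 → f c = 1 → w ^ k ≠ 1 → Commute c (w ^ k) →
    Commute c w

theorem IsTIQuotient.comp_subtype {f : X →* Q} (hf : IsTIQuotient f) (D : Subgroup X) :
    IsTIQuotient (f.comp D.subtype) where
  pow_eq_one y k hy hyk := Subtype.ext (hf.pow_eq_one y k hy hyk)
  exists_prime y w hy hw hw1 hyw := by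
    obtain ⟨r, hr, h1, h2⟩ := hf.exists_prime y w hy hw (fun h => hw1 (Subtype.ext h))
      (congrArg Subtype.val hyw)
    exact ⟨r, hr, Subtype.ext h1, Subtype.ext h2⟩
  commute_of_pow w c k hw hc hwk h :=
    Subtype.ext (hf.commute_of_pow w c k hw hc (fun h => hwk (Subtype.ext h))
      (congrArg Subtype.val h))

open scoped IsMulCommutative

/-- Automorphisms of a commutative group as additive endomorphisms. -/
def mulAutToAddMonoidEnd (A : Type*) [CommGroup A] : MulAut A →* AddMonoid.End (Additive A) where
  toFun e := MonoidHom.toAdditive e.toMonoidHom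
  map_one' := rfl
  map_mul' _ _ := rfl

theorem mulAutToAddMonoidEnd_injective (A : Type*) [CommGroup A] :
    Function.Injective (mulAutToAddMonoidEnd A) := fun a b h => by
  ext x
  exact DFunLike.congr_fun h (Additive.ofMul x)

theorem natCast_mul_addMonoidEnd_eq_zero {A : Type*} [CommGroup A] {p r : ℕ} (hp : p.Prime)
    (hr : r.Prime) (hrp : r ≠ p) (hA : IsPGroup p A) {s : AddMonoid.End (Additive A)}
    (h : (r : AddMonoid.End (Additive A)) * s = 0) : s = 0 := by
  ext a
  have h1 : (s a).toMul ^ r = 1 := by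
    have h2 : r • s a = 0 := by simpa using DFunLike.congr_fun h a
    exact h2
  obtain ⟨k, hk⟩ := hA (s a).toMul
  have h2 := Nat.eq_one_of_dvd_coprimes (Nat.coprime_pow_primes 1 k hr hp hrp)
    (by rw [pow_one]; exact orderOf_dvd_of_pow_eq_one h1) (orderOf_dvd_of_pow_eq_one hk)
  exact orderOf_eq_one_iff.1 h2

theorem natCast_addMonoidEnd_ne_zero {A : Type*} [CommGroup A] [Nontrivial A] {p r : ℕ}
    (hp : p.Prime) (hr : r.Prime) (hrp : r ≠ p) (hA : IsPGroup p A) :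
    (r : AddMonoid.End (Additive A)) ≠ 0 := fun h => by
  obtain ⟨a, ha⟩ := exists_ne (1 : A)
  have h1 := natCast_mul_addMonoidEnd_eq_zero hp hr hrp hA (s := 1) (by rw [h, zero_mul])
  exact ha (DFunLike.congr_fun h1 (Additive.ofMul a))

/-- The conjugation action on a commutative normal subgroup. -/
def conjEnd (E : Subgroup X) [E.Normal] [IsMulCommutative E] :
    X →* AddMonoid.End (Additive E) :=
  (mulAutToAddMonoidEnd E).comp MulAut.conjNormal

theorem conjEnd_eq_one_iff {E : Subgroup X} [E.Normal] [IsMulCommutative E] {x : X} :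
    conjEnd E x = 1 ↔ (MulAut.conjNormal x : MulAut E) = 1 := by
  rw [conjEnd, MonoidHom.comp_apply, map_eq_one_iff _ (mulAutToAddMonoidEnd_injective E)]

theorem mul_pow_eq_sum_conjEnd {E : Subgroup X} [E.Normal] [IsMulCommutative E] (e : E) (y : X)
    (n : ℕ) : (e * y) ^ n = (((∑ i ∈ Finset.range n, conjEnd E y ^ i)
      (Additive.ofMul e)).toMul : E) * y ^ n := by
  induction n with
  | zero => simp
  | succ n ih =>
    rw [pow_succ, ih, Finset.sum_range_succ, ← map_pow]
    have h1 : ((conjEnd E (y ^ n) (Additive.ofMul e)).toMul : X) = y ^ n * e * (y ^ n)⁻¹ :=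
      MulAut.conjNormal_apply (y ^ n) e
    have h2 (s t : AddMonoid.End (Additive E)) (a : Additive E) : (s + t) a = s a + t a := rfl
    rw [h2, toMul_add, Subgroup.coe_mul, h1]
    simp only [pow_succ]
    group

namespace IsTIQuotient

variable {f : X →* Q} (hf : IsTIQuotient f) {E : Subgroup X} [E.Normal] [IsMulCommutative E]

include hf

theorem sum_conjEnd_eq_zero (hE : E ≤ f.ker) {y : X} {r : ℕ} (hy : f y ≠ 1)
    (hyr : f (y ^ r) = 1) : ∑ i ∈ Finset.range r, conjEnd E y ^ i = 0 := by
  refine AddMonoidHom.ext fun e => ?_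
  have h1 := mul_pow_eq_sum_conjEnd e.toMul y r
  have h2 : f (e.toMul : E) = 1 := hE e.toMul.2
  have h3 : f ((e.toMul : E) * y) = f y := by rw [map_mul, h2, one_mul]
  rw [hf.pow_eq_one y r hy hyr, hf.pow_eq_one _ r (by rwa [h3])
    (by rwa [map_pow, h3, ← map_pow]), mul_one] at h1
  exact congrArg Additive.ofMul (Subtype.ext h1.symm)

/-- Structure of an `r`-group acting on a normal abelian `p`-subgroup of the kernel. -/
theorem exists_generator_of_isPGroup [Finite X] (hE : E ≤ f.ker) (hE1 : E ≠ ⊥) {p r : ℕ}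
    (hp : p.Prime) (hr : r.Prime) (hrp : r ≠ p) (hEp : IsPGroup p E) {Y : Subgroup X}
    (hY : IsPGroup r Y) (hYr : ∀ y ∈ Y, f y ≠ 1 → y ^ r = 1) (hY1 : ∃ y ∈ Y, f y ≠ 1) :
    (∀ c ∈ Y, f c = 1 → conjEnd E c = 1) ∧
      ∃ z ∈ Y, f z ≠ 1 ∧ ∀ c ∈ Y, f c ∈ Subgroup.zpowers (f z) := by
  have := Fact.mk hr
  have hEnt : Nontrivial E := (Subgroup.nontrivial_iff_ne_bot E).2 hE1
  have hr0 : (r : AddMonoid.End (Additive E)) ≠ 0 := natCast_addMonoidEnd_ne_zero hp hr hrp hEp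
  have hN : ∀ y ∈ Y, f y ≠ 1 → ∑ i ∈ Finset.range r, conjEnd E y ^ i = 0 := fun y hy hy1 =>
    hf.sum_conjEnd_eq_zero hE hy1 (by rw [hYr y hy hy1, map_one])
  have hne : ∀ y ∈ Y, f y ≠ 1 → conjEnd E y ≠ 1 := by
    intro y hy hy1 h
    have h1 := hN y hy hy1
    simp only [h, one_pow, Finset.sum_const, Finset.card_range, nsmul_eq_mul, mul_one] at h1
    exact hr0 h1
  have hop : ∀ a ∈ Y, ∀ b ∈ Y, Commute (conjEnd E a) (conjEnd E b) → conjEnd E b ^ r = 1 →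
      (∀ j < r, f (a * b ^ j) ≠ 1) → conjEnd E b = 1 := by
    intro a ha b hb hab hbr h
    refine sub_eq_zero.1 (natCast_mul_addMonoidEnd_eq_zero hp hr hrp hEp
      (natCast_mul_sub_one_eq_zero_of_sum_pow hr hab hbr fun j hj => ?_))
    have h1 := hN _ (Y.mul_mem ha (Y.pow_mem hb j)) (h j hj)
    rwa [map_mul, map_pow] at h1
  have hpow : ∀ b ∈ Y, conjEnd E b ≠ 1 → ∃ m : ℕ, conjEnd E (b ^ m) ≠ 1 ∧
      conjEnd E (b ^ m) ^ r = 1 := by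
    intro b hb hb1
    have hfin : IsOfFinOrder (conjEnd E b) := (conjEnd E).isOfFinOrder (isOfFinOrder_of_finite b)
    obtain ⟨k, hk⟩ := hY ⟨b, hb⟩
    have hk' : b ^ r ^ k = 1 := congrArg Subtype.val hk
    obtain ⟨m, -, hm⟩ := (Nat.dvd_prime_pow hr).1 (orderOf_dvd_of_pow_eq_one
      (show conjEnd E b ^ r ^ k = 1 by rw [← map_pow, hk', map_one]))
    have hrd : r ∣ orderOf (conjEnd E b) := by
      rcases m with - | m
      · rw [pow_zero, orderOf_eq_one_iff] at hm
        exact absurd hm hb1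
      · rw [hm, pow_succ]
        exact dvd_mul_left _ _
    have h1 := orderOf_pow_orderOf_div hfin.orderOf_pos.ne' hrd
    refine ⟨orderOf (conjEnd E b) / r, ?_, ?_⟩
    · intro h
      rw [← map_pow, h, orderOf_one] at h1
      exact hr.one_lt.ne h1
    · rw [map_pow]
      have h2 := pow_orderOf_eq_one (conjEnd E b ^ (orderOf (conjEnd E b) / r))
      rwa [h1] at h2
  obtain ⟨y₀, hy₀, hy₀1⟩ := hY1
  obtain ⟨z, hz, hz1, hzr, hzc⟩ : ∃ z ∈ Y, conjEnd E z ≠ 1 ∧ conjEnd E z ^ r = 1 ∧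
      ∀ c ∈ Y, Commute (conjEnd E z) (conjEnd E c) := by
    let ψ : X →* MulAut E := MulAut.conjNormal
    have hYψ : IsPGroup r (Y.map ψ) := hY.map ψ
    have : Nontrivial (Y.map ψ) := by
      refine ⟨⟨⟨ψ y₀, Subgroup.mem_map_of_mem ψ hy₀⟩, 1, fun h => ?_⟩⟩
      exact hne y₀ hy₀ hy₀1 (conjEnd_eq_one_iff.2 (congrArg Subtype.val h))
    have : Finite (Y.map ψ) := Set.Finite.to_subtype (Set.Finite.image _ (Set.toFinite _))
    obtain ⟨⟨⟨_, z, hz, rfl⟩, hzc⟩, hz1⟩ := @exists_ne _ hYψ.center_nontrivial 1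
    have hz1' : conjEnd E z ≠ 1 := fun h =>
      hz1 (Subtype.ext (Subtype.ext (conjEnd_eq_one_iff.1 h)))
    obtain ⟨m, hm1, hm⟩ := hpow z hz hz1'
    refine ⟨z ^ m, Y.pow_mem hz m, hm1, hm, fun c hc => ?_⟩
    rw [map_pow]
    refine Commute.pow_left ?_ m
    have h1 := Subgroup.mem_center_iff.1 hzc ⟨ψ c, Subgroup.mem_map_of_mem ψ hc⟩
    have h2 : ψ c * ψ z = ψ z * ψ c := congrArg Subtype.val h1
    exact (show Commute (ψ z) (ψ c) from h2.symm).map (mulAutToAddMonoidEnd E)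
  have hfz : f z ≠ 1 := fun h =>
    hz1 (hop y₀ hy₀ z hz (hzc y₀ hy₀).symm hzr fun j _ => by
      rwa [map_mul, map_pow, h, one_pow, mul_one])
  refine ⟨fun c hc hfc => ?_, z, hz, hfz, fun c hc => ?_⟩
  · by_contra hc1
    obtain ⟨m, hm1, hm⟩ := hpow c hc hc1
    exact hm1 (hop z hz _ (Y.pow_mem hc m) (hzc _ (Y.pow_mem hc m)) hm fun j _ => by
      rwa [map_mul, map_pow, map_pow, hfc, one_pow, one_pow, mul_one])
  · by_contra hcz
    have hfc : f c ≠ 1 := fun h => hcz (h ▸ Subgroup.one_mem _)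
    have hcr := hYr c hc hfc
    refine hne c hc hfc (hop z hz c hc (hzc c hc) (by rw [← map_pow, hcr, map_one]) ?_)
    intro j hj h
    rw [map_mul, map_pow] at h
    rcases eq_or_ne j 0 with rfl | hj0
    · rw [pow_zero, mul_one] at h
      exact hfz h
    · have hco : j.Coprime (orderOf (f c)) :=
        Nat.Coprime.coprime_dvd_right (orderOf_dvd_of_pow_eq_one (by rw [← map_pow, hcr, map_one]))
          (Nat.coprime_of_lt_prime hj0 hj hr).symm
      obtain ⟨m, hm⟩ := exists_pow_eq_self_of_coprime hco
      rw [← hm, ← inv_eq_of_mul_eq_one_right h] at hcz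
      exact hcz (Subgroup.pow_mem _ (Subgroup.inv_mem _ (Subgroup.mem_zpowers _)) _)

end IsTIQuotient
end Extension

section FinitePGroups

variable {X : Type*} [Group X]

theorem orderOf_eq_of_pow_eq_one_of_ne_one {x : X} {p : ℕ} (hp : p.Prime) (hx : x ^ p = 1)
    (hx1 : x ≠ 1) : orderOf x = p :=
  ((Nat.dvd_prime hp).1 (orderOf_dvd_of_pow_eq_one hx)).resolve_left
    fun h => hx1 (orderOf_eq_one_iff.1 h)

theorem exists_pow_eq_of_mem_zpowers {a u : X} {p : ℕ} (hp : p.Prime) (ha : orderOf a = p)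
    (hu : u ∈ Subgroup.zpowers a) (hu1 : u ≠ 1) : ∃ m : ℕ, u ^ m = a := by
  have hfin : IsOfFinOrder a := orderOf_pos_iff.1 (ha ▸ hp.pos)
  obtain ⟨j, rfl⟩ := hfin.mem_powers_iff_mem_zpowers.2 hu
  refine exists_pow_eq_self_of_coprime ?_
  rw [ha, Nat.coprime_comm, hp.coprime_iff_not_dvd]
  rintro ⟨c, rfl⟩
  refine hu1 ?_
  dsimp only
  rw [← ha, pow_mul, pow_orderOf_eq_one, one_pow]

theorem exists_pow_primary [Finite X] {p : ℕ} (hp : p.Prime) (x : X) :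
    ∃ m k : ℕ, ¬ p ∣ m ∧ (x ^ m) ^ p ^ k = 1 := by
  refine ⟨orderOf x / p ^ (orderOf x).factorization p, (orderOf x).factorization p,
    Nat.not_dvd_ordCompl hp (orderOf_pos x).ne', ?_⟩
  rw [← pow_mul, mul_comm, Nat.ordProj_mul_ordCompl_eq_self, pow_orderOf_eq_one]

theorem isPGroup_zpowers_of_pow_eq_one {p k : ℕ} {x : X} (hx : x ^ p ^ k = 1) :
    IsPGroup p (Subgroup.zpowers x) := by
  rintro ⟨_, j, rfl⟩
  refine ⟨k, Subtype.ext ?_⟩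
  change (x ^ j) ^ p ^ k = 1
  rw [← zpow_natCast, zpow_comm, zpow_natCast, hx, one_zpow]

theorem exists_mem_orderOf_eq [Finite X] {H : Subgroup X} {p : ℕ} (hp : p.Prime)
    (h : p ∣ Nat.card H) : ∃ x ∈ H, orderOf x = p := by
  have := Fact.mk hp
  obtain ⟨x, hx⟩ := exists_prime_orderOf_dvd_card' p h
  exact ⟨x, x.2, by rw [Subgroup.orderOf_coe, hx]⟩

theorem exists_commute_of_mem_normalizer [Finite X] {p : ℕ} [Fact p.Prime] {E : Subgroup X}
    (hE : IsPGroup p E) (hE1 : E ≠ ⊥) {y : X} (hy : y ∈ Subgroup.normalizer (E : Set X)) {k : ℕ}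
    (hyk : y ^ p ^ k = 1) : ∃ c ∈ E, c ≠ 1 ∧ Commute c y := by
  let y' : Subgroup.normalizer (E : Set X) := ⟨y, hy⟩
  have hC : IsPGroup p (Subgroup.zpowers y') :=
    isPGroup_zpowers_of_pow_eq_one (k := k) (Subtype.ext hyk)
  let act : MulAction (Subgroup.zpowers y') E :=
    MulAction.compHom E (E.normalizerMonoidHom.comp (Subgroup.zpowers y').subtype)
  have : Nontrivial E := (Subgroup.nontrivial_iff_ne_bot E).2 hE1
  obtain ⟨n, hn, hcard⟩ := hE.nontrivial_iff_card.1 this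
  have h1 : (1 : E) ∈ MulAction.fixedPoints (Subgroup.zpowers y') E := fun g =>
    map_one (E.normalizerMonoidHom (g : Subgroup.normalizer (E : Set X)))
  obtain ⟨c, hc, hc1⟩ := hC.exists_fixed_point_of_prime_dvd_card_of_fixed_point E
    (by rw [hcard]; exact dvd_pow_self p hn.ne') h1
  refine ⟨c, c.2, fun h => hc1 (Subtype.ext h.symm), ?_⟩
  have h2 : y * c * y⁻¹ = c :=
    congrArg Subtype.val (hc ⟨y', Subgroup.mem_zpowers y'⟩)
  exact (mul_inv_eq_iff_eq_mul.1 h2).symm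

end FinitePGroups

namespace IsTIQuotient

variable {X Q : Type*} [Group X] [Group Q] [Finite X] {f : X →* Q} (hf : IsTIQuotient f)

theorem exists_restrict (hs : Function.Surjective f) {p : ℕ} (hp : p.Prime)
    (hpk : p ∣ Nat.card f.ker) : ∃ (D : Subgroup X) (E : Subgroup D),
      Function.Surjective (f.comp D.subtype) ∧ E.Normal ∧ IsMulCommutative E ∧ E ≠ ⊥ ∧
        IsPGroup p E ∧ E ≤ (f.comp D.subtype).ker := by
  have := Fact.mk hp
  obtain ⟨R⟩ : Nonempty (Sylow p f.ker) := inferInstance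
  let R' : Subgroup X := (R : Subgroup f.ker).map f.ker.subtype
  have hR' : IsPGroup p R' := R.2.map _
  let D : Subgroup X := Subgroup.normalizer (R' : Set X)
  have hD : D ⊔ f.ker = ⊤ := Sylow.normalizer_sup_eq_top R
  let T : Subgroup D := R'.subgroupOf D
  have hT : T.Normal := Subgroup.normal_in_normalizer
  have hTp : IsPGroup p T := hR'.comap_subtype
  have hcardR : p ∣ Nat.card R := R.dvd_card_of_dvd_card hpk
  have hTnt : Nontrivial T := by
    obtain ⟨x, hx, hxp⟩ := exists_mem_orderOf_eq (H := (R : Subgroup f.ker)) hp hcardR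
    have hx' : (x : X) ∈ R' := Subgroup.mem_map_of_mem _ hx
    refine ⟨⟨⟨⟨x, Subgroup.le_normalizer hx'⟩, hx'⟩, 1, fun h => ?_⟩⟩
    have h1 : x = 1 := Subtype.ext (congrArg (fun t : T => ((t : D) : X)) h)
    rw [h1, orderOf_one] at hxp
    exact hp.one_lt.ne hxp
  have : Nontrivial (Subgroup.center T) := hTp.center_nontrivial
  refine ⟨D, (Subgroup.center T).map T.subtype, ?_, inferInstance, inferInstance, ?_, ?_, ?_⟩
  · intro q
    obtain ⟨x, rfl⟩ := hs q
    obtain ⟨d, hd, k, hk, rfl⟩ := Subgroup.mem_sup_of_normal_right.1 (hD ▸ Subgroup.mem_top x)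
    refine ⟨⟨d, hd⟩, ?_⟩
    rw [map_mul, MonoidHom.mem_ker.1 hk, mul_one]
    rfl
  · rw [Ne, Subgroup.map_eq_bot_iff_of_injective _ T.subtype_injective]
    exact (Subgroup.nontrivial_iff_ne_bot _).1 this
  · exact (hTp.to_subgroup _).map _
  · rintro _ ⟨t, -, rfl⟩
    obtain ⟨k, -, hk⟩ := Subgroup.mem_subgroupOf.1 t.2
    have h1 : f (k : X) = 1 := k.2
    rw [MonoidHom.mem_ker]
    change f ((t : D) : X) = 1
    rw [← hk]
    exact h1

include hf

theorem pow_prime_eq_one {l : ℕ} (hl : l.Prime) (hlk : l ∣ Nat.card f.ker) {y : X} {k : ℕ}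
    (hy : y ^ l ^ k = 1) (hfy : f y ≠ 1) : y ^ l = 1 := by
  have := Fact.mk hl
  obtain ⟨L, hL⟩ := (isPGroup_zpowers_of_pow_eq_one hy).exists_le_sylow
  obtain ⟨z, hz, hzl⟩ := exists_mem_orderOf_eq hl hlk
  have hz1 : z ≠ 1 := by
    rintro rfl
    rw [orderOf_one] at hzl
    exact hl.one_lt.ne hzl
  obtain ⟨R, hR⟩ := (isPGroup_zpowers_of_pow_eq_one (p := l) (k := 1) (x := z)
    (by rw [pow_one, ← hzl, pow_orderOf_eq_one])).exists_le_sylow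
  obtain ⟨g, hg⟩ := MulAction.exists_smul_eq X R L
  have hgz : g * z * g⁻¹ ∈ (L : Subgroup X) := by
    rw [← hg, Sylow.coe_subgroup_smul]
    exact Subgroup.smul_mem_pointwise_smul z (MulAut.conj g) _ (hR (Subgroup.mem_zpowers z))
  have hE1 : (L : Subgroup X) ⊓ f.ker ≠ ⊥ := by
    intro h
    have h1 : g * z * g⁻¹ ∈ (L : Subgroup X) ⊓ f.ker :=
      ⟨hgz, (inferInstance : f.ker.Normal).conj_mem z hz g⟩
    rw [h, Subgroup.mem_bot, conj_eq_one_iff] at h1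
    exact hz1 h1
  have hyL : y ∈ (L : Subgroup X) := hL (Subgroup.mem_zpowers y)
  have hyN : y ∈ Subgroup.normalizer (((L : Subgroup X) ⊓ f.ker : Subgroup X) : Set X) := by
    rw [Subgroup.mem_normalizer_iff]
    intro h
    rw [Subgroup.mem_inf, Subgroup.mem_inf, Subgroup.mul_mem_cancel_right _ (inv_mem hyL),
      Subgroup.mul_mem_cancel_left _ hyL, MonoidHom.mem_ker, MonoidHom.mem_ker, map_mul, map_mul,
      map_inv, conj_eq_one_iff]
  obtain ⟨c, hc, hc1, hcy⟩ := exists_commute_of_mem_normalizer (p := l)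
    (L.2.to_le inf_le_left) hE1 hyN hy
  obtain ⟨r, hr, hyr, hcr⟩ := hf.exists_prime y c hfy hc.2 hc1 hcy.symm
  have hy1 : y ≠ 1 := fun h => hfy (by rw [h, map_one])
  have h2 := orderOf_dvd_of_pow_eq_one hy
  rw [orderOf_eq_of_pow_eq_one_of_ne_one hr hyr hy1] at h2
  rwa [← (Nat.prime_dvd_prime_iff_eq hr hl).1 (hr.dvd_of_dvd_pow h2)]

theorem card_sylow_eq (hs : Function.Surjective f) {l p : ℕ} [Fact l.Prime] (hp : p.Prime)
    (hlp : l ≠ p) (hlk : l ∣ Nat.card f.ker) (hpk : p ∣ Nat.card f.ker) (hlQ : l ∣ Nat.card Q)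
    (L : Sylow l Q) : Nat.card L = l := by
  have hl : l.Prime := Fact.out
  have : Finite Q := Finite.of_surjective f hs
  obtain ⟨D, E, hgs, hEn, hEc, hE1, hEp, hEk⟩ := exists_restrict hs hp hpk
  set g := f.comp D.subtype with hg
  obtain ⟨Y⟩ : Nonempty (Sylow l D) := inferInstance
  have hYr : ∀ y ∈ (Y : Subgroup D), g y ≠ 1 → y ^ l = 1 := by
    intro y hy hgy
    obtain ⟨k, hk⟩ := mem_primaryElements_of_isPGroup Y.2 hy
    exact Subtype.ext (hf.pow_prime_eq_one hl hlk (k := k) (congrArg Subtype.val hk) hgy)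
  have hcard : Nat.card ((Y : Subgroup D).map g) = l ^ (Nat.card Q).factorization l := by
    rw [← Sylow.coe_mapSurjective hgs]
    exact Sylow.card_eq_multiplicity _
  have hfac : (Nat.card Q).factorization l ≠ 0 :=
    (hl.factorization_pos_of_dvd Nat.card_pos.ne' hlQ).ne'
  have hY1 : ∃ y ∈ (Y : Subgroup D), g y ≠ 1 := by
    by_contra! h
    have h1 : (Y : Subgroup D).map g = ⊥ := by
      rw [eq_bot_iff]
      rintro _ ⟨y, hy, rfl⟩
      exact h y hy
    rw [h1, Subgroup.card_bot] at hcard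
    exact hfac (Nat.pow_eq_one.1 hcard.symm |>.resolve_left hl.one_lt.ne')
  obtain ⟨-, z, hz, hz1, hzY⟩ := (hf.comp_subtype D).exists_generator_of_isPGroup hEk hE1 hp hl hlp
    hEp Y.2 hYr hY1
  have h1 : (Y : Subgroup D).map g ≤ Subgroup.zpowers (g z) := by
    rintro _ ⟨y, hy, rfl⟩
    exact hzY y hy
  have h2 := Subgroup.card_dvd_of_le h1
  rw [Nat.card_zpowers, orderOf_eq_of_pow_eq_one_of_ne_one hl
    (by rw [← map_pow, hYr z hz hz1, map_one]) hz1, hcard] at h2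
  rw [Sylow.card_eq_multiplicity]
  exact Nat.dvd_antisymm h2 (dvd_pow_self l hfac)

end IsTIQuotient

namespace IsTIQuotient

variable {X Q : Type*} [Group X] [Group Q] [Finite X] {f : X →* Q} (hf : IsTIQuotient f)

include hf

theorem not_commute_of_orderOf (hs : Function.Surjective f) {l r : ℕ} (hl : l.Prime)
    (hr : r.Prime) (hlr : l ≠ r) (hlk : l ∣ Nat.card f.ker) {a b : Q} (ha : orderOf a = l)
    (hb : orderOf b = r) : ¬ Commute a b := by
  intro hab
  have := Fact.mk hl
  obtain ⟨D, E, hgs, hEn, -, hE1, hEp, hEk⟩ := exists_restrict hs hl hlk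
  have hg := hf.comp_subtype D
  set g := f.comp D.subtype
  obtain ⟨w, hw⟩ := hgs (a * b)
  have hord : orderOf (a * b) = l * r := by
    rw [hab.orderOf_mul_eq_mul_orderOf_of_coprime, ha, hb]
    rw [ha, hb]
    exact (Nat.coprime_primes hl hr).2 hlr
  have hgw : g w ≠ 1 := by
    rw [hw, Ne, ← orderOf_eq_one_iff, hord]
    exact fun h => hl.one_lt.ne' (Nat.eq_one_of_mul_eq_one_right h)
  have hgwr : g (w ^ r) ≠ 1 := by
    rw [map_pow, hw, Ne, ← orderOf_dvd_iff_pow_eq_one, hord]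
    intro h
    exact hlr ((Nat.prime_dvd_prime_iff_eq hl hr).1 ((dvd_mul_right l r).trans h))
  have hwl : (w ^ r) ^ l ^ 1 = 1 := by
    rw [pow_one]
    refine hg.pow_eq_one _ l hgwr ?_
    rw [map_pow, map_pow, hw, ← pow_mul, mul_comm, ← hord, pow_orderOf_eq_one]
  obtain ⟨c, hc, hc1, hcw⟩ := exists_commute_of_mem_normalizer hEp hE1
    (by rw [Subgroup.normalizer_eq_top]; exact Subgroup.mem_top _) hwl
  have hcw' := hg.commute_of_pow w c r hgw (hEk hc) (fun h => hgwr (by rw [h, map_one])) hcw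
  obtain ⟨s, hsp, hws, -⟩ := hg.exists_prime w c hgw (hEk hc) hc1 hcw'.symm
  have h1 : l * r ∣ s := by
    rw [← hord, orderOf_dvd_iff_pow_eq_one, ← hw, ← map_pow, hws, map_one]
  exact hlr (((Nat.prime_dvd_prime_iff_eq hl hsp).1 ((dvd_mul_right l r).trans h1)).trans
    ((Nat.prime_dvd_prime_iff_eq hr hsp).1 ((dvd_mul_left r l).trans h1)).symm)

open scoped IsMulCommutative in
theorem not_normal_zpowers (hs : Function.Surjective f) {l p r : ℕ} (hl : l.Prime)
    (hp : p.Prime) (hr : r.Prime) (hlp : l ≠ p) (hlr : l ≠ r) (hlk : l ∣ Nat.card f.ker)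
    (hpk : p ∣ Nat.card f.ker) {a b : Q} (ha : orderOf a = l) (hb : orderOf b = r) :
    ¬ (Subgroup.zpowers a).Normal := by
  intro hA
  have hlF := Fact.mk hl
  have hnc := hf.not_commute_of_orderOf hs hl hr hlr hlk ha hb
  obtain ⟨D, E, hgs, hEn, hEc, hE1, hEp, hEk⟩ := exists_restrict hs hp hpk
  have hg := hf.comp_subtype D
  have hexp : ∀ (y : D) (k : ℕ), y ^ l ^ k = 1 → f.comp D.subtype y ≠ 1 → y ^ l = 1 :=
    fun y k hy hgy =>
      Subtype.ext (hf.pow_prime_eq_one hl hlk (k := k) (congrArg Subtype.val hy) hgy)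
  set g := f.comp D.subtype
  set A := Subgroup.zpowers a
  have ha1 : a ≠ 1 := by
    rintro rfl
    rw [orderOf_one] at ha
    exact hl.one_lt.ne ha
  -- an element centralizing a nontrivial element of `A` centralizes `a`
  have hcent : ∀ u ∈ A, u ≠ 1 → ∀ x, Commute u x → Commute a x := by
    intro u hu hu1 x hux
    obtain ⟨m, hm⟩ := exists_pow_eq_of_mem_zpowers hl ha hu hu1
    rw [← hm]
    exact hux.pow_left m
  have hAcomm : ∀ u ∈ A, Commute a u := by
    rintro _ ⟨j, rfl⟩
    exact (Commute.refl a).zpow_right j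
  let Δ : Subgroup D := A.comap g
  obtain ⟨x, hx⟩ := hgs a
  obtain ⟨m, k, hm, hk⟩ := exists_pow_primary hl x
  have hxΔ : x ^ m ∈ Δ := Δ.pow_mem (show g x ∈ A by rw [hx]; exact Subgroup.mem_zpowers a) m
  obtain ⟨Y, hY⟩ := (isPGroup_zpowers_of_pow_eq_one (p := l) (k := k) (x := (⟨x ^ m, hxΔ⟩ : Δ))
    (Subtype.ext hk)).exists_le_sylow
  let Y' : Subgroup D := (Y : Subgroup Δ).map Δ.subtype
  have hY'p : IsPGroup l Y' := Y.2.map _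
  have hY'A : ∀ y ∈ Y', g y ∈ A := by
    rintro _ ⟨y, -, rfl⟩
    exact y.2
  have hyY : x ^ m ∈ Y' := ⟨⟨x ^ m, hxΔ⟩, hY (Subgroup.mem_zpowers _), rfl⟩
  set y := x ^ m with hy
  have hgy : g y ≠ 1 := by
    rw [hy, map_pow, hx, Ne, ← orderOf_dvd_iff_pow_eq_one, ha]
    exact hm
  have hYr : ∀ y ∈ Y', g y ≠ 1 → y ^ l = 1 := by
    intro y hy hgy
    obtain ⟨k, hk⟩ := mem_primaryElements_of_isPGroup hY'p hy
    exact hexp y k hk hgy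
  have hC1 := (hg.exists_generator_of_isPGroup hEk hE1 hp hl hlp hEp hY'p hYr
    ⟨y, hyY, hgy⟩).1
  have hfr : Subgroup.normalizer (Y' : Set D) ⊔ Δ = ⊤ := Sylow.normalizer_sup_eq_top Y
  obtain ⟨t₀, ht₀⟩ := hgs b
  obtain ⟨t, ht, δ, hδ, htδ⟩ := Subgroup.mem_sup_of_normal_right.1 (hfr ▸ Subgroup.mem_top t₀)
  have hgt : g t * g δ = b := by rw [← map_mul, htδ, ht₀]
  have hδA : g δ ∈ A := hδ
  have hnct : ¬ Commute a (g t) := fun h => hnc (hgt ▸ h.mul_right (hAcomm _ hδA))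
  have hgt1 : g t ≠ 1 := fun h => hnct (h ▸ Commute.one_right a)
  have hgtrA : g t ^ r ∈ A := by
    rw [← QuotientGroup.eq_one_iff, QuotientGroup.mk_pow]
    have h1 : ((g t : Q) : Q ⧸ A) = (b : Q) := by
      rw [← hgt, QuotientGroup.mk_mul, (QuotientGroup.eq_one_iff _).2 hδA, mul_one]
    rw [h1, ← QuotientGroup.mk_pow, ← hb, pow_orderOf_eq_one, QuotientGroup.mk_one]
  have hgtr : g t ^ r = 1 := by
    by_contra h
    exact hnct (hcent _ hgtrA h _ ((Commute.refl _).pow_left r))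
  have hNt : ∑ i ∈ Finset.range r, conjEnd E t ^ i = 0 :=
    hg.sum_conjEnd_eq_zero hEk hgt1 (by rw [map_pow, hgtr])
  have hyl := hYr y hyY hgy
  have hNy : ∑ i ∈ Finset.range l, conjEnd E y ^ i = 0 :=
    hg.sum_conjEnd_eq_zero hEk hgy (by rw [hyl, map_one])
  have hEnt : Nontrivial E := (Subgroup.nontrivial_iff_ne_bot E).2 hE1
  refine natCast_addMonoidEnd_ne_zero hp hl hlp hEp (natCast_eq_zero_of_sum_pow_of_twist hl hr.pos
    (by rw [← map_pow, hyl, map_one]) hNy hNt fun i hi0 hir => ?_)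
  have hgyl : orderOf (g y) = l :=
    orderOf_eq_of_pow_eq_one_of_ne_one hl (by rw [← map_pow, hyl, map_one]) hgy
  have hconj : t ^ i * y * (t ^ i)⁻¹ ∈ Y' :=
    (Subgroup.mem_normalizer_iff.1 (Subgroup.pow_mem _ ht i) y).1 hyY
  obtain ⟨n, hn⟩ := exists_pow_eq_of_mem_zpowers hl ha (hY'A y hyY) hgy
  obtain ⟨j, hj⟩ : g (t ^ i * y * (t ^ i)⁻¹) ∈ Submonoid.powers a :=
    (orderOf_pos_iff.1 (ha ▸ hl.pos)).mem_powers_iff_mem_zpowers.2 (hY'A _ hconj)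
  have hkj : g (t ^ i * y * (t ^ i)⁻¹) = g y ^ (n * j) := by
    rw [pow_mul, hn]; exact hj.symm
  refine ⟨n * j, ?_, fun hmod => ?_⟩
  · have h1 : conjEnd E (t ^ i * y * (t ^ i)⁻¹ * (y ^ (n * j))⁻¹) = 1 := by
      refine hC1 _ (Y'.mul_mem hconj (Y'.inv_mem (Y'.pow_mem hyY _))) ?_
      rw [map_mul, hkj, map_inv, map_pow g y, mul_inv_cancel]
    have h2 : t ^ i * y = (t ^ i * y * (t ^ i)⁻¹ * (y ^ (n * j))⁻¹) * (y ^ (n * j) * t ^ i) := by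
      group
    rw [← map_pow, ← map_mul, h2, map_mul, h1, one_mul, map_mul, map_pow]
  · rw [(pow_eq_pow_iff_modEq (n := n * j) (m := 1)).2 (hgyl ▸ hmod), pow_one, map_mul, map_mul,
      map_inv, mul_inv_eq_iff_eq_mul, map_pow] at hkj
    have h1 : Commute a (g t ^ i) := hcent _ (hY'A y hyY) hgy _ hkj.symm
    have hco : i.Coprime (orderOf (g t)) :=
      Nat.Coprime.coprime_dvd_right (orderOf_dvd_of_pow_eq_one hgtr)
        (Nat.coprime_of_lt_prime hi0.ne' hir hr).symm
    obtain ⟨c, hc⟩ := exists_pow_eq_self_of_coprime hco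
    exact hnct (hc ▸ h1.pow_right c)

theorem not_conj_mem_zpowers (hs : Function.Surjective f) {l p r : ℕ} (hl : l.Prime)
    (hp : p.Prime) (hr : r.Prime) (hlp : l ≠ p) (hlr : l ≠ r) (hlk : l ∣ Nat.card f.ker)
    (hpk : p ∣ Nat.card f.ker) {a b : Q} (ha : orderOf a = l) (hb : orderOf b = r) :
    b ∉ Subgroup.normalizer (Subgroup.zpowers a : Set Q) := by
  intro hbN
  let N : Subgroup Q := Subgroup.normalizer (Subgroup.zpowers a : Set Q)
  let F : N.comap f →* N := f.subgroupComap N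
  have hF : IsTIQuotient F := by
    have h1 := hf.comp_subtype (N.comap f)
    refine ⟨fun y k hy hyk => ?_, fun y w hy hw => ?_, fun w c k hw hc => ?_⟩
    · exact h1.pow_eq_one y k (fun h => hy (Subtype.ext h)) (congrArg Subtype.val hyk)
    · exact h1.exists_prime y w (fun h => hy (Subtype.ext h)) (congrArg Subtype.val hw)
    · exact h1.commute_of_pow w c k (fun h => hw (Subtype.ext h)) (congrArg Subtype.val hc)
  have hFs : Function.Surjective F := f.subgroupComap_surjective_of_surjective N hs
  have hdvd : ∀ {q : ℕ}, q.Prime → q ∣ Nat.card f.ker → q ∣ Nat.card F.ker := by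
    intro q hq hqk
    obtain ⟨w, hw, hwq⟩ := exists_mem_orderOf_eq hq hqk
    rw [MonoidHom.mem_ker] at hw
    let w' : N.comap f := ⟨w, show f w ∈ N by rw [hw]; exact N.one_mem⟩
    have hw' : w' ∈ F.ker := Subtype.ext hw
    rw [← hwq, show orderOf w = orderOf w' from Subgroup.orderOf_coe w']
    exact Subgroup.orderOf_dvd_natCard _ hw'
  have haN : a ∈ N := Subgroup.le_normalizer (Subgroup.mem_zpowers a)
  refine hF.not_normal_zpowers hFs hl hp hr hlp hlr (hdvd hl hlk) (hdvd hp hpk)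
    (a := ⟨a, haN⟩) (b := ⟨b, hbN⟩) (by rw [← ha, ← Subgroup.orderOf_coe])
    (by rw [← hb, ← Subgroup.orderOf_coe]) ?_
  have h1 : (Subgroup.zpowers a).subgroupOf N = Subgroup.zpowers (⟨a, haN⟩ : N) := by
    ext z
    rw [Subgroup.mem_subgroupOf, Subgroup.mem_zpowers_iff, Subgroup.mem_zpowers_iff]
    simp only [Subtype.ext_iff, Subgroup.coe_zpow]
  rw [← h1]
  exact Subgroup.normal_in_normalizer

end IsTIQuotient

section Fusion

variable {Q : Type*} [Group Q] [Finite Q]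

theorem false_of_sylow_card_prime {l q : ℕ} [hlF : Fact l.Prime] [hqF : Fact q.Prime]
    (hlq : l ≠ q) (hqQ : q ∣ Nat.card Q)
    (hcl : ∀ L : Sylow l Q, Nat.card L = l) (hcq : ∀ L : Sylow q Q, Nat.card L = q)
    (hNl : ∀ (r : ℕ) (a b : Q), r.Prime → l ≠ r → orderOf a = l → orderOf b = r →
      b ∉ Subgroup.normalizer (Subgroup.zpowers a : Set Q))
    (hNq : ∀ a b : Q, orderOf a = q → orderOf b = l →
      b ∉ Subgroup.normalizer (Subgroup.zpowers a : Set Q)) : False := by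
  have hzp : ∀ {s : ℕ} (_ : s.Prime) {H : Subgroup Q} {x : Q}, Nat.card H = s → x ∈ H →
      orderOf x = s → Subgroup.zpowers x = H := fun {s} _ {H x} hH hx hxs =>
    Subgroup.eq_of_le_of_card_ge ((Subgroup.zpowers_le).2 hx) (by rw [Nat.card_zpowers, hxs, hH])
  obtain ⟨L⟩ : Nonempty (Sylow l Q) := inferInstance
  obtain ⟨a, haL, ha⟩ := exists_mem_orderOf_eq (H := (L : Subgroup Q)) hlF.out
    (by rw [hcl L])
  have hLa : Subgroup.zpowers a = (L : Subgroup Q) := hzp hlF.out (hcl L) haL ha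
  have hNL : IsPGroup l (Subgroup.normalizer ((L : Subgroup Q) : Set Q)) := by
    refine IsPGroup.of_card (Nat.eq_prime_pow_of_unique_prime_dvd Nat.card_pos.ne'
      fun {r} hr hrN => ?_)
    by_contra hrl
    obtain ⟨b, hb, hbr⟩ := exists_mem_orderOf_eq hr hrN
    exact hNl r a b hr (Ne.symm hrl) ha hbr (by rwa [hLa])
  have hNL' := L.is_maximal' hNL Subgroup.le_normalizer
  have hcent : Subgroup.normalizer ((L : Subgroup Q) : Set Q) ≤
      Subgroup.centralizer ((L : Subgroup Q) : Set Q) := by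
    rw [hNL', ← hLa]
    intro x hx y hy
    obtain ⟨i, rfl⟩ := hx
    obtain ⟨j, rfl⟩ := hy
    exact ((Commute.refl a).zpow_zpow j i).eq
  have hcompl := MonoidHom.ker_transferSylow_isComplement' L hcent
  have hlM := MonoidHom.not_dvd_card_ker_transferSylow L hcent
  set M := (MonoidHom.transferSylow L hcent).ker with hMdef
  have hMn : M.Normal := inferInstance
  have hqM : q ∣ Nat.card M := by
    have h1 := hcompl.card_mul_card
    rw [hcl L] at h1
    rw [← h1] at hqQ
    exact (hqF.out.dvd_mul.1 hqQ).resolve_right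
      fun h => hlq ((Nat.prime_dvd_prime_iff_eq hqF.out hlF.out).1 h).symm
  obtain ⟨B⟩ : Nonempty (Sylow q M) := inferInstance
  let B' : Subgroup Q := (B : Subgroup M).map M.subtype
  have hB'p : IsPGroup q B' := B.2.map _
  have hqB : q ∣ Nat.card B' := by
    rw [Subgroup.card_map_of_injective M.subtype_injective]
    exact B.dvd_card_of_dvd_card hqM
  have hB'c : Nat.card B' = q := by
    obtain ⟨C, hC⟩ := hB'p.exists_le_sylow
    exact Nat.dvd_antisymm (hcq C ▸ Subgroup.card_dvd_of_le hC) hqB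
  obtain ⟨c, hcB, hc⟩ := exists_mem_orderOf_eq hqF.out hqB
  have hBc : Subgroup.zpowers c = B' := hzp hqF.out hB'c hcB hc
  have hfr : Subgroup.normalizer (B' : Set Q) ⊔ M = ⊤ := Sylow.normalizer_sup_eq_top B
  obtain ⟨n, hn, m, hm, hnm⟩ := Subgroup.mem_sup_of_normal_right.1 (hfr ▸ Subgroup.mem_top a)
  have haM : a ∉ M := fun h =>
    hlM (ha ▸ Subgroup.orderOf_dvd_natCard M h)
  have hln : l ∣ orderOf n := by
    have h1 : (n : Q ⧸ M) = (a : Q) := by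
      rw [← hnm, QuotientGroup.mk_mul, (QuotientGroup.eq_one_iff _).2 hm, mul_one]
    have h2 : orderOf ((a : Q) : Q ⧸ M) = l :=
      orderOf_eq_of_pow_eq_one_of_ne_one hlF.out
        (by rw [← QuotientGroup.mk_pow, ← ha, pow_orderOf_eq_one, QuotientGroup.mk_one])
        (fun h => haM ((QuotientGroup.eq_one_iff _).1 h))
    rw [← h2, ← h1]
    exact orderOf_map_dvd (QuotientGroup.mk' M) n
  refine hNq c (n ^ (orderOf n / l)) hc (orderOf_pow_orderOf_div (orderOf_pos n).ne' hln) ?_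
  rw [hBc]
  exact Subgroup.pow_mem _ hn _

end Fusion

theorem IsTIQuotient.false_of_primes {X Q : Type*} [Group X] [Group Q] [Finite X] {f : X →* Q}
    (hf : IsTIQuotient f) (hs : Function.Surjective f) {l q : ℕ} (hl : l.Prime) (hq : q.Prime)
    (hlq : l ≠ q) (hlk : l ∣ Nat.card f.ker) (hqk : q ∣ Nat.card f.ker) (hlQ : l ∣ Nat.card Q)
    (hqQ : q ∣ Nat.card Q) : False := by
  have := Fact.mk hl
  have := Fact.mk hq
  have : Finite Q := Finite.of_surjective f hs
  exact false_of_sylow_card_prime hlq hqQ (hf.card_sylow_eq hs hq hlq hlk hqk hlQ)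
    (hf.card_sylow_eq hs hl hlq.symm hqk hlk hqQ)
    (fun r a b hr hlr ha hb => hf.not_conj_mem_zpowers hs hl hq hr hlq hlr hlk hqk ha hb)
    (fun a b ha hb => hf.not_conj_mem_zpowers hs hq hl hl hlq.symm hlq.symm hqk hlk ha hb)

section PartitionHull

variable {G : Type*} [Group G] {P : Finset (Subgroup G)}

/-- The intersection of all the conjugates of members of `P` that contain `x`. -/
def partitionHull (P : Finset (Subgroup G)) (x : G) : Subgroup G where
  carrier := {y | ∀ H ∈ P, ∀ g : G, g * x * g⁻¹ ∈ H → g * y * g⁻¹ ∈ H}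
  one_mem' H _ g _ := by simp
  mul_mem' {a b} ha hb H hH g hg := by
    have h1 := H.mul_mem (ha H hH g hg) (hb H hH g hg)
    rwa [conj_mul] at h1
  inv_mem' {a} ha H hH g hg := by
    have h1 := H.inv_mem (ha H hH g hg)
    rwa [conj_inv] at h1

theorem mem_partitionHull_self (x : G) : x ∈ partitionHull P x := fun _ _ _ h => h

theorem partitionHull_le {x : G} {H : Subgroup G} (hH : H ∈ P) (hx : x ∈ H) :
    partitionHull P x ≤ H := by
  intro y hy
  simpa using hy H hH 1 (by simpa using hx)

theorem conj_mem_partitionHull_conj {x y : G} (g : G) (h : y ∈ partitionHull P x) :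
    g * y * g⁻¹ ∈ partitionHull P (g * x * g⁻¹) := by
  intro H hH k hk
  have h1 := h H hH (k * g) (by simpa [mul_assoc] using hk)
  simpa [mul_assoc] using h1

namespace IsStrictPartition

variable (hP : IsStrictPartition ⊥ P)

include hP

theorem eq_of_mem {H K : Subgroup G} (hH : H ∈ P) (hK : K ∈ P) {x : G} (hx : x ≠ 1)
    (hxH : x ∈ H) (hxK : x ∈ K) : H = K := by
  by_contra hne
  have h1 : x ∈ H ⊓ K := ⟨hxH, hxK⟩
  rw [hP.2.2.2 H hH K hK hne] at h1
  exact hx h1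

theorem mem_partitionHull_symm {x y : G} (hy : y ≠ 1) (h : y ∈ partitionHull P x) :
    x ∈ partitionHull P y := by
  intro H hH g hg
  obtain ⟨K, hK, hxK⟩ := hP.2.2.1 (g * x * g⁻¹)
  rwa [hP.eq_of_mem hH hK (fun h => hy (conj_eq_one_iff.1 h)) hg (h K hK g hxK)]

theorem partitionHull_eq {x y : G} (hy : y ≠ 1) (h : y ∈ partitionHull P x) :
    partitionHull P y = partitionHull P x := by
  have h' := hP.mem_partitionHull_symm hy h
  exact le_antisymm (fun z hz H hH g hg => hz H hH g (h H hH g hg))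
    fun z hz H hH g hg => hz H hH g (h' H hH g hg)

theorem partitionHull_eq_of_mem {x y z : G} (hz : z ≠ 1) (hx : z ∈ partitionHull P x)
    (hy : z ∈ partitionHull P y) : partitionHull P x = partitionHull P y :=
  (hP.partitionHull_eq hz hx).symm.trans (hP.partitionHull_eq hz hy)

theorem mem_partitionHull_of_pow {x y : G} {k : ℕ} (hyk : y ^ k ≠ 1)
    (h : y ^ k ∈ partitionHull P x) : y ∈ partitionHull P x := by
  rw [hP.partitionHull_eq_of_mem hyk h (Subgroup.pow_mem _ (mem_partitionHull_self y) k)]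
  exact mem_partitionHull_self y

theorem pow_eq_one_of_commute {x y : G} (hx : x ≠ 1) (hxy : Commute x y)
    (hne : partitionHull P x ≠ partitionHull P y) {n : ℕ} (hn : x ^ n = 1) : y ^ n = 1 := by
  by_contra hyn
  have h1 : (x * y) ^ n = y ^ n := by rw [hxy.mul_pow, hn, one_mul]
  have h2 : x * y ∈ partitionHull P y := by
    refine hP.mem_partitionHull_of_pow (k := n) (h1 ▸ hyn) ?_
    rw [h1]
    exact Subgroup.pow_mem _ (mem_partitionHull_self y) n
  rw [Subgroup.mul_mem_cancel_right _ (mem_partitionHull_self y)] at h2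
  exact hne (hP.partitionHull_eq hx h2)

theorem exists_prime_of_commute [Finite G] {x y : G} (hx : x ≠ 1) (hy : y ≠ 1)
    (hxy : Commute x y) (hne : partitionHull P x ≠ partitionHull P y) :
    ∃ r : ℕ, r.Prime ∧ x ^ r = 1 ∧ y ^ r = 1 := by
  obtain ⟨p, hp, m, hm⟩ := Nat.exists_prime_and_dvd (fun h => hx (orderOf_eq_one_iff.1 h))
  have hxp : x ^ p = 1 := by
    by_contra hxp
    have h1 : y ^ m = 1 := by
      refine hP.pow_eq_one_of_commute hxp (hxy.pow_left p) ?_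
        (by rw [← pow_mul, ← hm, pow_orderOf_eq_one])
      rwa [hP.partitionHull_eq hxp (Subgroup.pow_mem _ (mem_partitionHull_self x) p)]
    have h2 := orderOf_dvd_of_pow_eq_one (hP.pow_eq_one_of_commute hy hxy.symm hne.symm h1)
    have hm0 : 0 < m := Nat.pos_of_ne_zero fun h => (orderOf_pos x).ne' (by rw [hm, h, mul_zero])
    have h3 := Nat.le_of_dvd hm0 h2
    rw [hm] at h3
    nlinarith [hp.two_le]
  exact ⟨p, hp, hxp, hP.pow_eq_one_of_commute hx hxy hne hxp⟩

theorem conj_mem_of_conj_mem {v w g : G} (hw : w ≠ 1)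
    (hwv : w ∈ partitionHull P v) (hgw : g * w * g⁻¹ ∈ partitionHull P v) {z : G}
    (hz : z ∈ partitionHull P v) : g * z * g⁻¹ ∈ partitionHull P v := by
  rw [← hP.partitionHull_eq hw hwv] at hz
  rw [← hP.partitionHull_eq (fun h => hw (conj_eq_one_iff.1 h)) hgw]
  exact conj_mem_partitionHull_conj g hz

theorem isTIQuotient [Finite G] (v : G) :
    IsTIQuotient (QuotientGroup.mk' ((partitionHull P v).subgroupOf
      (Subgroup.normalizer (partitionHull P v : Set G)))) := by
  set W := partitionHull P v
  set X := Subgroup.normalizer (W : Set G)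
  have hker : ∀ y : X, QuotientGroup.mk' (W.subgroupOf X) y = 1 ↔ (y : G) ∈ W := fun y =>
    QuotientGroup.eq_one_iff y
  have hsub : ∀ x : G, partitionHull P x = W → x ∈ W := fun x hx => by
    rw [← hx]
    exact mem_partitionHull_self x
  refine ⟨fun y k hy hyk => ?_, fun y w hy hw hw1 hyw => ?_, fun w c k hw hc hwk hcw => ?_⟩
  · rw [Ne, hker] at hy
    rw [hker] at hyk
    by_contra h
    exact hy (hP.mem_partitionHull_of_pow (k := k) (fun h' => h (Subtype.ext h')) hyk)
  · rw [Ne, hker] at hy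
    rw [hker] at hw
    have hw1' : (w : G) ≠ 1 := fun h => hw1 (Subtype.ext h)
    obtain ⟨r, hr, h1, h2⟩ := hP.exists_prime_of_commute (x := (y : G)) (y := w)
      (fun h => hy (h ▸ W.one_mem)) hw1' (congrArg Subtype.val hyw)
      (fun h => hy (by
        rw [hP.partitionHull_eq hw1' hw] at h
        exact hsub _ h))
    exact ⟨r, hr, Subtype.ext h1, Subtype.ext h2⟩
  · rw [Ne, hker] at hw
    rw [hker] at hc
    have hwk' : (w : G) ^ k ≠ 1 := fun h => hwk (Subtype.ext h)
    have hcw' : Commute (c : G) (w ^ k) := congrArg Subtype.val hcw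
    have hkw : (w : G) ^ k ∈ partitionHull P (w : G) :=
      Subgroup.pow_mem _ (mem_partitionHull_self _) k
    have h1 : (c : G) * w * (c : G)⁻¹ ∈ partitionHull P (w : G) :=
      hP.conj_mem_of_conj_mem hwk' hkw (by rwa [hcw'.eq, mul_inv_cancel_right])
        (mem_partitionHull_self _)
    have h2 : (c : G) * w * (c : G)⁻¹ * (w : G)⁻¹ ∈ partitionHull P (w : G) :=
      Subgroup.mul_mem _ h1 (Subgroup.inv_mem _ (mem_partitionHull_self _))
    have h3 : (c : G) * w * (c : G)⁻¹ * (w : G)⁻¹ ∈ W := by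
      rw [mul_assoc, mul_assoc]
      refine W.mul_mem hc ?_
      rw [← mul_assoc]
      exact (Subgroup.mem_normalizer_iff.1 w.2 _).1 (W.inv_mem hc)
    have h4 : (c : G) * w * (c : G)⁻¹ * (w : G)⁻¹ = 1 := by
      by_contra h
      exact hw (hsub _ (hP.partitionHull_eq_of_mem h h2 h3))
    exact Subtype.ext (mul_inv_eq_iff_eq_mul.1 (mul_inv_eq_one.1 h4))

end IsStrictPartition

theorem IsESPartition.dvd_card_normalizer_quotient [Finite G] (hP : IsESPartition ⊥ P) {v : G}
    {l : ℕ} (hl : l.Prime) (hlW : l ∣ Nat.card (partitionHull P v)) :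
    l ∣ Nat.card (Subgroup.normalizer (partitionHull P v : Set G) ⧸
      (partitionHull P v).subgroupOf (Subgroup.normalizer (partitionHull P v : Set G))) := by
  have := Fact.mk hl
  set W := partitionHull P v
  set X := Subgroup.normalizer (W : Set G)
  obtain ⟨H, hH, hvH⟩ := hP.1.2.2.1 v
  have hWH : W ≤ H := partitionHull_le hH hvH
  have hlG : l ∣ Nat.card G := hlW.trans (Subgroup.card_subgroup_dvd_card W)
  obtain ⟨L⟩ : Nonempty (Sylow l W) := inferInstance
  let L' : Subgroup G := (L : Subgroup W).map W.subtype
  have hL'W : L' ≤ W := Subgroup.map_subtype_le _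
  have hL'p : IsPGroup l L' := L.2.map _
  obtain ⟨R, hR⟩ := hL'p.exists_le_sylow
  have hlt : L'.subgroupOf R < ⊤ := by
    rw [lt_top_iff_ne_top, Ne, Subgroup.subgroupOf_eq_top]
    intro hRL
    refine hP.not_ordProj_dvd_card hH hl hlG ?_
    rw [← Sylow.card_eq_multiplicity R]
    exact Subgroup.card_dvd_of_le (hRL.trans (hL'W.trans hWH))
  have : Group.IsNilpotent R := R.2.isNilpotent
  obtain ⟨g, hgN, hgL⟩ := SetLike.exists_of_lt (Group.normalizerCondition_of_isNilpotent _ hlt)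
  have hgL' : (g : G) ∉ L' := hgL
  have hgn : ∀ z ∈ L', (g : G) * z * (g : G)⁻¹ ∈ L' := fun z hz =>
    (Subgroup.mem_normalizer_iff.1 hgN ⟨z, hR hz⟩).1 hz
  obtain ⟨z, hz, hzl⟩ := exists_mem_orderOf_eq (H := L') hl (by
    rw [Subgroup.card_map_of_injective W.subtype_injective]
    exact L.dvd_card_of_dvd_card hlW)
  have hz1 : z ≠ 1 := by
    rintro rfl
    rw [orderOf_one] at hzl
    exact hl.one_lt.ne hzl
  have hgX : (g : G) ∈ X := by
    refine Subgroup.mem_normalizer_fintype fun w hw => ?_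
    exact hP.1.conj_mem_of_conj_mem hz1 (hL'W hz) (hL'W (hgn z hz)) hw
  have hgW : (g : G) ∉ W := by
    intro hgW
    have h1 := L.is_maximal' (Q := (R : Subgroup G).comap W.subtype) R.2.comap_subtype
      fun x hx => hR (Subgroup.mem_map_of_mem _ hx)
    have h2 : (⟨g, hgW⟩ : W) ∈ (L : Subgroup W) := by
      rw [← h1]
      exact g.2
    exact hgL' ⟨_, h2, rfl⟩
  obtain ⟨k, hk⟩ := mem_primaryElements_of_isPGroup R.2 g.2
  have hgq : ((⟨g, hgX⟩ : X) : X ⧸ W.subgroupOf X) ≠ 1 := fun h =>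
    hgW ((QuotientGroup.eq_one_iff (⟨g, hgX⟩ : X)).1 h)
  refine (dvd_orderOf_of_mem_primaryElements hl (x := ((⟨g, hgX⟩ : X) : X ⧸ W.subgroupOf X))
    ⟨k, ?_⟩ hgq).trans (orderOf_dvd_natCard _)
  rw [← QuotientGroup.mk_pow, show (⟨g, hgX⟩ : X) ^ l ^ k = 1 from Subtype.ext hk,
    QuotientGroup.mk_one]

end PartitionHull

section Frattini

variable {G : Type*} [Group G] [Finite G] {P : Finset (Subgroup G)}

theorem IsESPartition.isEPPO (hP : IsESPartition ⊥ P) : IsEPPO G := by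
  intro p q hp hq hpq x y hx hy hxy
  have hx1 : x ≠ 1 := by
    rintro rfl
    rw [orderOf_one] at hx
    exact hp.one_lt.ne hx
  have hy1 : y ≠ 1 := by
    rintro rfl
    rw [orderOf_one] at hy
    exact hq.one_lt.ne hy
  have hW : partitionHull P x = partitionHull P y := by
    by_contra hne
    obtain ⟨r, hr, hxr, hyr⟩ := hP.1.exists_prime_of_commute hx1 hy1 hxy hne
    rw [← hx, ← hy, orderOf_eq_of_pow_eq_one_of_ne_one hr hxr hx1,
      orderOf_eq_of_pow_eq_one_of_ne_one hr hyr hy1] at hpq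
    exact hpq rfl
  have hpW : p ∣ Nat.card (partitionHull P x) :=
    hx ▸ Subgroup.orderOf_dvd_natCard _ (mem_partitionHull_self x)
  have hqW : q ∣ Nat.card (partitionHull P x) :=
    hy ▸ Subgroup.orderOf_dvd_natCard _ (hW ▸ mem_partitionHull_self y)
  have hker : Nat.card (QuotientGroup.mk' ((partitionHull P x).subgroupOf
      (Subgroup.normalizer (partitionHull P x : Set G)))).ker = Nat.card (partitionHull P x) := by
    rw [QuotientGroup.ker_mk']
    exact Nat.card_congr (Subgroup.subgroupOfEquivOfLe Subgroup.le_normalizer).toEquiv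
  exact (hP.1.isTIQuotient x).false_of_primes (QuotientGroup.mk'_surjective _) hp hq hpq
    (hker.symm ▸ hpW) (hker.symm ▸ hqW) (hP.dvd_card_normalizer_quotient hp hpW)
    (hP.dvd_card_normalizer_quotient hq hqW)

theorem IsESPartition.map_mk' {S : Subgroup G} [S.Normal] (hP : IsESPartition S P) :
    ∃ P' : Finset (Subgroup (G ⧸ S)), IsESPartition ⊥ P' := by
  classical
  have hle : ∀ H ∈ P, S ≤ H := by
    intro H hH
    obtain ⟨K, hK, hKH⟩ := Finset.exists_mem_ne hP.1.1 H
    rw [← hP.1.2.2.2 H hH K hK hKH.symm]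
    exact inf_le_left
  have hcomap : ∀ H ∈ P, (H.map (QuotientGroup.mk' S)).comap (QuotientGroup.mk' S) = H := by
    intro H hH
    rw [Subgroup.comap_map_eq, QuotientGroup.ker_mk', sup_eq_left.2 (hle H hH)]
  refine ⟨P.image (Subgroup.map (QuotientGroup.mk' S)), ⟨?_, ?_, ?_, ?_⟩, ?_⟩
  · rw [Finset.card_image_of_injOn]
    · exact hP.1.1
    · intro H hH K hK hHK
      rw [← hcomap H hH, ← hcomap K hK]
      exact congrArg _ hHK
  · rw [Finset.forall_mem_image]
    intro H hH h
    refine hP.1.2.1 H hH ?_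
    rw [← hcomap H hH, h, Subgroup.comap_top]
  · intro g
    obtain ⟨g, rfl⟩ := QuotientGroup.mk'_surjective S g
    obtain ⟨H, hH, hgH⟩ := hP.1.2.2.1 g
    exact ⟨_, Finset.mem_image_of_mem _ hH, Subgroup.mem_map_of_mem _ hgH⟩
  · rw [Finset.forall_mem_image]
    intro H hH
    rw [Finset.forall_mem_image]
    intro K hK hne
    refine Subgroup.comap_injective (QuotientGroup.mk'_surjective S) ?_
    rw [Subgroup.comap_inf, hcomap H hH, hcomap K hK, MonoidHom.comap_bot, QuotientGroup.ker_mk']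
    exact hP.1.2.2.2 H hH K hK fun h => hne (h ▸ rfl)
  · rw [Finset.forall_mem_image]
    intro H hH
    rw [Finset.forall_mem_image]
    intro K hK
    have hindex : ∀ H ∈ P, (H.map (QuotientGroup.mk' S)).index = H.index := by
      intro H hH
      rw [← Subgroup.index_comap_of_surjective _ (QuotientGroup.mk'_surjective S), hcomap H hH]
    have h1 : H.index = K.index := by
      refine Nat.eq_of_mul_eq_mul_left (Nat.card_pos (α := H)) ?_
      rw [H.card_mul_index, hP.2 H hH K hK, K.card_mul_index]
    refine Nat.eq_of_mul_eq_mul_right (Nat.pos_of_ne_zero H.index_ne_zero_of_finite) ?_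
    rw [← hindex H hH, Subgroup.card_mul_index, hindex H hH, h1, ← hindex K hK,
      Subgroup.card_mul_index]

theorem isPGroup_of_quotient_frattini {p : ℕ} [Fact p.Prime]
    (h : IsPGroup p (G ⧸ frattini G)) : IsPGroup p G := by
  obtain ⟨R⟩ : Nonempty (Sylow p G) := inferInstance
  have hsup : (R : Subgroup G) ⊔ frattini G = ⊤ := by
    rw [← Subgroup.index_eq_one]
    obtain ⟨n, hn⟩ := h.exists_card_eq
    have h1 : ((R : Subgroup G) ⊔ frattini G).index ∣ p ^ n := by
      rw [← hn]
      exact Subgroup.index_dvd_of_le le_sup_right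
    have h2 : ((R : Subgroup G) ⊔ frattini G).index ∣ (R : Subgroup G).index :=
      Subgroup.index_dvd_of_le le_sup_left
    obtain ⟨k, -, hk⟩ := (Nat.dvd_prime_pow Fact.out).1 h1
    have h3 := R.not_dvd_index
    rw [hk] at h2 ⊢
    cases k with
    | zero => rw [pow_zero]
    | succ k => exact absurd ((dvd_pow_self p k.succ_ne_zero).trans h2) h3
  have htop := frattini_nongenerating hsup
  intro g
  obtain ⟨k, hk⟩ := R.2 ⟨g, by rw [htop]; exact Subgroup.mem_top g⟩
  exact ⟨k, congrArg Subtype.val hk⟩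

end Frattini

theorem isPGroup_of_frattini_ESPartition {G : Type*} [Group G] [Finite G]
    (hnc : ¬ IsCyclic G) (P : Finset (Subgroup G))
    (hP : IsESPartition (frattini G) P) :
    ∃ p : ℕ, p.Prime ∧ IsPGroup p G := by
  obtain ⟨P', hP'⟩ := hP.map_mk'
  obtain ⟨p, hp, h⟩ := hP'.exists_isPGroup_of_isEPPO hP'.isEPPO
  have := Fact.mk hp
  exact ⟨p, hp, isPGroup_of_quotient_frattini h⟩
end

section
/- Let G be a finite Schmidt group, i.e. G is not nilpotent but every proper subgroup of G is nilpotent. Then G has no ES-partition for any subgroup S of G, and every proper non-cyclic subgroup H of G has an ET-partition for some subgroup T of H. -/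
theorem Subgroup.index_prime_of_isCoatom {G : Type*} [Group G] [Finite G] {M : Subgroup G}
    [M.Normal] (hM : IsCoatom M) : M.index.Prime := by
  have h1 : M.index ≠ 1 := fun h => hM.1 (Subgroup.index_eq_one.1 h)
  obtain ⟨p, hp, hpd⟩ := Nat.exists_prime_and_dvd h1
  have := Fact.mk hp
  obtain ⟨x, hx⟩ := exists_prime_orderOf_dvd_card' (G := G ⧸ M) p hpd
  have hle : M ≤ (Subgroup.zpowers x).comap (QuotientGroup.mk' M) := by
    intro m hm
    rw [Subgroup.mem_comap, QuotientGroup.mk'_apply, (QuotientGroup.eq_one_iff m).2 hm]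
    exact one_mem _
  have htop : (Subgroup.zpowers x).comap (QuotientGroup.mk' M) = ⊤ := by
    refine hM.2 _ (lt_of_le_of_ne hle fun h => ?_)
    obtain ⟨g, rfl⟩ := QuotientGroup.mk'_surjective M x
    have hg : g ∈ M := by
      rw [h, Subgroup.mem_comap]
      exact Subgroup.mem_zpowers _
    rw [QuotientGroup.mk'_apply, (QuotientGroup.eq_one_iff g).2 hg, orderOf_one] at hx
    exact hp.ne_one hx.symm
  have : Subgroup.zpowers x = ⊤ := by
    rw [← Subgroup.index_eq_one, ← Subgroup.index_comap_of_surjective _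
      (QuotientGroup.mk'_surjective M), htop, Subgroup.index_top]
  have hc : M.index = p := by
    rw [Subgroup.index, ← hx, ← Nat.card_zpowers, this, Subgroup.card_top]
  rwa [hc]

theorem Subgroup.exists_isESPartition_of_index_eq {G : Type*} [Group G] [Finite G] {p : ℕ}
    (hp : p.Prime) {M N : Subgroup G} [M.Normal] [N.Normal] (hne : M ≠ N)
    (hM : M.index = p) (hN : N.index = p) :
    ∃ P : Finset (Subgroup G), IsESPartition (M ⊓ N) P := by
  classical
  have := Fact.mk hp
  have index_lt : ∀ {K L : Subgroup G}, K ≤ L → K ≠ L → L.index < K.index := by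
    intro K L hKL h
    exact Subgroup.index_strictAnti (lt_of_le_of_ne hKL h)
  have eq_of_index : ∀ {K L : Subgroup G}, K ≤ L → K.index = L.index → K = L := by
    intro K L hKL h
    by_contra h'
    exact absurd (index_lt hKL h') (by omega)
  have hsup : M ⊔ N = ⊤ := by
    have hd := Subgroup.index_dvd_of_le (le_sup_left : M ≤ M ⊔ N)
    rw [hM, Nat.dvd_prime hp, Subgroup.index_eq_one] at hd
    refine hd.resolve_right fun h => hne ?_
    rw [eq_of_index le_sup_left (hM.trans h.symm)]
    exact (eq_of_index le_sup_right (hN.trans h.symm)).symm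
  have hT : (M ⊓ N).index = p * p := by
    have h := Subgroup.relIndex_mul_index (inf_le_left : M ⊓ N ≤ M)
    rw [Subgroup.inf_relIndex_left, ← Subgroup.relIndex_sup_right M N, hsup,
      Subgroup.relIndex_top_right, hM, hN] at h
    exact h.symm
  have hmem : ∀ K : Subgroup G,
      K ∈ (Set.toFinite {K : Subgroup G | M ⊓ N ≤ K ∧ K.index = p}).toFinset ↔
        M ⊓ N ≤ K ∧ K.index = p := by simp
  refine ⟨(Set.toFinite {K : Subgroup G | M ⊓ N ≤ K ∧ K.index = p}).toFinset,
    ⟨?_, ?_, ?_, ?_⟩, ?_⟩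
  · exact Finset.one_lt_card.2 ⟨M, (hmem M).2 ⟨inf_le_left, hM⟩, N,
      (hmem N).2 ⟨inf_le_right, hN⟩, hne⟩
  · intro H hH h
    have := ((hmem H).1 hH).2
    rw [h, Subgroup.index_top] at this
    exact hp.ne_one this.symm
  · intro g
    by_cases hg : g ∈ M ⊓ N
    · exact ⟨M, (hmem M).2 ⟨inf_le_left, hM⟩, hg.1⟩
    · refine ⟨(Subgroup.zpowers (QuotientGroup.mk' (M ⊓ N) g)).comap (QuotientGroup.mk' (M ⊓ N)),
        (hmem _).2 ⟨?_, ?_⟩, ?_⟩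
      · intro m hm
        have h : QuotientGroup.mk' (M ⊓ N) m = 1 := (QuotientGroup.eq_one_iff m).2 hm
        rw [Subgroup.mem_comap, h]
        exact one_mem _
      · have ho : orderOf (QuotientGroup.mk' (M ⊓ N) g) = p := by
          refine orderOf_eq_prime ?_ ?_
          · rw [← map_pow, QuotientGroup.mk'_apply, QuotientGroup.eq_one_iff]
            exact ⟨hM ▸ M.pow_index_mem g, hN ▸ N.pow_index_mem g⟩
          · rwa [QuotientGroup.mk'_apply, Ne, QuotientGroup.eq_one_iff]
        rw [Subgroup.index_comap_of_surjective _ (QuotientGroup.mk'_surjective _)]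
        have h := Subgroup.card_mul_index (Subgroup.zpowers (QuotientGroup.mk' (M ⊓ N) g))
        rw [Nat.card_zpowers, ho, ← Subgroup.index, hT] at h
        exact Nat.eq_of_mul_eq_mul_left hp.pos h
      · rw [Subgroup.mem_comap]
        exact Subgroup.mem_zpowers _
  · intro H hH K hK hHK
    obtain ⟨hH1, hH2⟩ := (hmem H).1 hH
    obtain ⟨hK1, hK2⟩ := (hmem K).1 hK
    have hd := Subgroup.index_dvd_of_le (le_inf hH1 hK1)
    rw [hT, ← sq, Nat.dvd_prime_pow hp] at hd
    obtain ⟨k, hk, hk'⟩ := hd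
    have hlt : H.index < (H ⊓ K).index := index_lt inf_le_left fun h => hHK <| by
      rw [inf_eq_left] at h
      exact eq_of_index h (hH2.trans hK2.symm)
    have : k = 2 := by
      interval_cases k
      · rw [hk', hH2, pow_zero] at hlt; exact absurd hlt (by have := hp.pos; omega)
      · rw [hk', hH2, pow_one] at hlt; exact absurd hlt (lt_irrefl _)
      · rfl
    refine (eq_of_index (le_inf hH1 hK1) ?_).symm
    rw [hk', this, hT, sq]
  · intro H hH K hK
    have h1 := H.card_mul_index
    have h2 := K.card_mul_index
    rw [((hmem H).1 hH).2] at h1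
    rw [((hmem K).1 hK).2, ← h1] at h2
    exact (Nat.eq_of_mul_eq_mul_right hp.pos h2).symm

theorem Group.isCyclic_of_isCoatom_index_injective {G : Type*} [Group G] [Finite G]
    (hnorm : ∀ M : Subgroup G, IsCoatom M → M.Normal)
    (hinj : ∀ M N : Subgroup G, IsCoatom M → IsCoatom N → M.index = N.index → M = N) :
    IsCyclic G := by
  classical
  have separate : ∀ M : Subgroup G, IsCoatom M →
      ∃ y, y ∉ M ∧ ∀ N : Subgroup G, IsCoatom N → N ≠ M → y ∈ N := by
    intro M hM
    have := hnorm M hM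
    have hp := Subgroup.index_prime_of_isCoatom hM
    obtain ⟨x, hx⟩ : ∃ x, x ∉ M := by
      by_contra! h
      exact hM.1 ((Subgroup.eq_top_iff' M).2 h)
    set p := M.index with hpM
    have hcard : Nat.card G ≠ 0 := Nat.card_pos.ne'
    refine ⟨x ^ (ordCompl[p] (Nat.card G)), ?_, ?_⟩
    · intro h
      have hcop : Nat.Coprime p (ordCompl[p] (Nat.card G)) := Nat.coprime_ordCompl hp hcard
      apply hx
      rw [← QuotientGroup.eq_one_iff, ← orderOf_eq_one_iff]
      refine Nat.eq_one_of_dvd_coprimes hcop ?_ ?_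
      · exact orderOf_dvd_natCard _
      · rw [orderOf_dvd_iff_pow_eq_one]
        exact (QuotientGroup.eq_one_iff (N := M) _).2 h
    · intro N hN hNM
      have := hnorm N hN
      have hq := Subgroup.index_prime_of_isCoatom hN
      have hne : N.index ≠ p := fun h => hNM (hinj N M hN hM h)
      have hd : N.index ∣ ordCompl[p] (Nat.card G) := by
        have h1 : N.index ∣ ordProj[p] (Nat.card G) * ordCompl[p] (Nat.card G) := by
          rw [Nat.ordProj_mul_ordCompl_eq_self]
          exact N.index_dvd_card
        refine Nat.Coprime.dvd_of_dvd_mul_left ?_ h1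
        exact Nat.Coprime.pow_right _ ((Nat.coprime_primes hq hp).2 hne)
      obtain ⟨c, hc⟩ := hd
      rw [hc, pow_mul]
      exact pow_mem (N.pow_index_mem x) c
  have avoid : ∀ s : Finset (Subgroup G), (∀ M ∈ s, IsCoatom M) → ∃ x, ∀ M ∈ s, x ∉ M := by
    intro s
    induction s using Finset.induction_on with
    | empty => exact fun _ => ⟨1, by simp⟩
    | insert M s hMs ih =>
      intro hs
      obtain ⟨x, hx⟩ := ih fun N hN => hs N (Finset.mem_insert_of_mem hN)
      by_cases hxM : x ∈ M
      · obtain ⟨y, hyM, hy⟩ := separate M (hs M (Finset.mem_insert_self _ _))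
        refine ⟨x * y, fun N hN => ?_⟩
        rcases Finset.mem_insert.1 hN with rfl | hN'
        · rwa [Subgroup.mul_mem_cancel_left _ hxM]
        · rw [Subgroup.mul_mem_cancel_right _ (hy N (hs N hN) (fun h => hMs (h ▸ hN')))]
          exact hx N hN'
      · refine ⟨x, fun N hN => ?_⟩
        rcases Finset.mem_insert.1 hN with rfl | hN'
        · exact hxM
        · exact hx N hN'
  obtain ⟨x, hx⟩ := avoid (Set.toFinite {M : Subgroup G | IsCoatom M}).toFinset (by simp)
  refine isCyclic_iff_exists_zpowers_eq_top.2 ⟨x, ?_⟩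
  refine (eq_top_or_exists_le_coatom _).resolve_right ?_
  rintro ⟨M, hM, hle⟩
  exact hx M (by simpa using hM) (hle (Subgroup.mem_zpowers x))

theorem Group.IsNilpotent.exists_isESPartition {G : Type*} [Group G] [Finite G]
    (hnil : Group.IsNilpotent G) (hcyc : ¬ IsCyclic G) :
    ∃ (T : Subgroup G) (P : Finset (Subgroup G)), IsESPartition T P := by
  have hnorm : ∀ M : Subgroup G, IsCoatom M → M.Normal :=
    (Group.isNilpotent_of_finite_tfae.out 0 2 rfl rfl).1 hnil
  have : ∃ M N : Subgroup G, IsCoatom M ∧ IsCoatom N ∧ M.index = N.index ∧ M ≠ N := by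
    by_contra! h
    exact hcyc (Group.isCyclic_of_isCoatom_index_injective hnorm h)
  obtain ⟨M, N, hM, hN, hMN, hne⟩ := this
  have := hnorm M hM
  have := hnorm N hN
  exact ⟨_, Subgroup.exists_isESPartition_of_index_eq
    (Subgroup.index_prime_of_isCoatom hM) hne rfl hMN.symm⟩

theorem Subgroup.image_conj_out_eq {G : Type*} [Group G] (H : Subgroup G) :
    (fun a : (G ⧸ H) × H => a.1.out * a.2 * a.1.out⁻¹) '' (Set.univ ×ˢ {1}ᶜ) =
      {g : G | g ≠ 1 ∧ ∃ x, x * g * x⁻¹ ∈ H} := by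
  ext g
  constructor
  · rintro ⟨⟨q, h⟩, ⟨-, hh⟩, rfl⟩
    refine ⟨fun h' => hh ?_, q.out⁻¹, ?_⟩
    · simpa using h'
    · simp [mul_assoc]
  · rintro ⟨hg, x, hx⟩
    obtain ⟨k, hk⟩ := QuotientGroup.mk_out_eq_mul H x⁻¹
    refine ⟨(((x⁻¹ : G) : G ⧸ H), k⁻¹ * ⟨_, hx⟩ * k), ⟨trivial, fun h => hg ?_⟩, ?_⟩
    · have h' : (⟨_, hx⟩ : H) = 1 := by
        rw [← conj_eq_one_iff (a := k⁻¹), inv_inv]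
        exact h
      exact conj_eq_one_iff.1 (congrArg Subtype.val h')
    · simp only [hk]
      push_cast
      group

theorem Subgroup.ncard_univ_prod_compl_one {G : Type*} [Group G] [Finite G] (H : Subgroup G) :
    (Set.univ ×ˢ {1}ᶜ : Set ((G ⧸ H) × H)).ncard = Nat.card G - H.index := by
  rw [Set.ncard_prod, Set.ncard_univ, Set.ncard_compl, Set.ncard_singleton, Nat.mul_sub, mul_one,
    ← Subgroup.card_eq_card_quotient_mul_card_subgroup, Subgroup.index]

theorem Subgroup.ncard_conj_le {G : Type*} [Group G] [Finite G] (H : Subgroup G) :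
    {g : G | g ≠ 1 ∧ ∃ x, x * g * x⁻¹ ∈ H}.ncard ≤ Nat.card G - H.index := by
  rw [← H.image_conj_out_eq, ← H.ncard_univ_prod_compl_one]
  exact Set.ncard_image_le

theorem Subgroup.ncard_conj_eq {G : Type*} [Group G] [Finite G] {H : Subgroup G}
    (hH : ∀ x g, g ≠ 1 → g ∈ H → x * g * x⁻¹ ∈ H → x ∈ H) :
    {g : G | g ≠ 1 ∧ ∃ x, x * g * x⁻¹ ∈ H}.ncard = Nat.card G - H.index := by
  rw [← H.image_conj_out_eq, ← H.ncard_univ_prod_compl_one]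
  refine Set.InjOn.ncard_image ?_
  rintro ⟨q, h⟩ ⟨-, hh⟩ ⟨q', h'⟩ ⟨-, -⟩ heq
  have heq : q.out * (h : G) * q.out⁻¹ = q'.out * h' * q'.out⁻¹ := heq
  have hq : q'.out⁻¹ * q.out ∈ H := by
    refine hH _ h (fun h1 => hh (Subtype.ext h1)) h.2 ?_
    have : q'.out⁻¹ * q.out * (h : G) * (q'.out⁻¹ * q.out)⁻¹ = h' := by
      calc _ = q'.out⁻¹ * (q.out * (h : G) * q.out⁻¹) * q'.out := by group
        _ = _ := by rw [heq]; group
    rw [this]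
    exact h'.2
  have hqq : q = q' := by
    rw [← q.out_eq', ← q'.out_eq']
    exact (QuotientGroup.eq.2 hq).symm
  subst hqq
  simpa using heq

theorem Subgroup.exists_not_mem_conj {G : Type*} [Group G] [Finite G] {H : Subgroup G}
    (hH : H ≠ ⊤) : ∃ g : G, ∀ x, x * g * x⁻¹ ∉ H := by
  by_contra! h
  have hle := H.ncard_conj_le
  have hset : {g : G | g ≠ 1 ∧ ∃ x, x * g * x⁻¹ ∈ H} = {1}ᶜ := by
    ext g
    simp [h g]
  rw [hset, Set.ncard_compl, Set.ncard_singleton] at hle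
  have h0 := Nat.card_pos (α := G)
  have h1 : H.index ≠ 1 := fun h1 => hH (Subgroup.index_eq_one.1 h1)
  have h2 : H.index ≠ 0 := Subgroup.index_ne_zero_of_finite
  have h3 := Nat.le_of_dvd h0 H.index_dvd_card
  omega

theorem Subgroup.lt_inf_normalizer {G : Type*} [Group G] [Finite G] {D M : Subgroup G}
    (hM : Group.IsNilpotent M) (h : D < M) : D < M ⊓ Subgroup.normalizer (D : Set G) := by
  have hc := (Group.isNilpotent_of_finite_tfae (G := M)).out 0 1 rfl rfl |>.1 hM
  have hlt := hc (D.subgroupOf M) (lt_top_iff_ne_top.2 fun h' =>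
    h.not_ge (Subgroup.subgroupOf_eq_top.1 h'))
  obtain ⟨x, hx, hxD⟩ := SetLike.exists_of_lt hlt
  refine lt_of_le_of_ne (le_inf h.le Subgroup.le_normalizer) fun heq => hxD ?_
  rw [Subgroup.mem_subgroupOf, heq]
  refine Subgroup.mem_inf.2 ⟨x.2, ?_⟩
  rw [Subgroup.mem_normalizer_iff] at hx ⊢
  intro g
  constructor
  · intro hg
    simpa [Subgroup.mem_subgroupOf] using (hx ⟨g, h.le hg⟩).1 hg
  · intro hg
    have hgM : g ∈ M := by
      have := M.mul_mem (M.mul_mem (M.inv_mem x.2) (h.le hg)) x.2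
      simpa [mul_assoc] using this
    exact (hx ⟨g, hgM⟩).2 hg

theorem Group.IsNilpotent.of_isCyclic {G : Type*} [Group G] (h : IsCyclic G) :
    Group.IsNilpotent G := by
  let := IsCyclic.commGroup (α := G)
  infer_instance

theorem Group.inf_eq_bot_of_isCoatom {G : Type*} [Group G] [Finite G]
    (hsub : ∀ H : Subgroup G, H ≠ ⊤ → Group.IsNilpotent H)
    (hsimple : ∀ N : Subgroup G, N.Normal → N = ⊥ ∨ N = ⊤) {M L : Subgroup G}
    (hM : IsCoatom M) (hL : IsCoatom L) (hne : M ≠ L) : M ⊓ L = ⊥ := by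
  by_contra hbot
  obtain ⟨⟨M, L⟩, ⟨hM, hL, hne, hbot⟩, hmax⟩ :=
    Set.Finite.exists_maximalFor (fun a : Subgroup G × Subgroup G => a.1 ⊓ a.2)
      {a | IsCoatom a.1 ∧ IsCoatom a.2 ∧ a.1 ≠ a.2 ∧ a.1 ⊓ a.2 ≠ ⊥} (Set.toFinite _)
      ⟨(M, L), hM, hL, hne, hbot⟩
  simp only at hM hL hne hbot
  have hlt : M ⊓ L < M := inf_lt_left.2 fun h => hne (by
    by_contra h'
    exact hL.1 (hM.2 L (lt_of_le_of_ne h h')))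
  have hlt' : M ⊓ L < L := inf_lt_right.2 fun h => hne (by
    by_contra h'
    exact hM.1 (hL.2 M (lt_of_le_of_ne h (Ne.symm h'))))
  have hntop : Subgroup.normalizer ((M ⊓ L : Subgroup G) : Set G) ≠ ⊤ := fun h =>
    (hsimple _ (Subgroup.normalizer_eq_top_iff.1 h)).elim hbot
      fun h => hM.1 (top_le_iff.1 (h ▸ inf_le_left))
  obtain ⟨K, hK, hKle⟩ := (eq_top_or_exists_le_coatom _).resolve_left hntop
  have key : ∀ A : Subgroup G, IsCoatom A → M ⊓ L < A → A = K := by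
    intro A hA h
    by_contra hAK
    have h1 : M ⊓ L < A ⊓ K :=
      (Subgroup.lt_inf_normalizer (hsub A hA.1) h).trans_le (inf_le_inf_left A hKle)
    exact h1.not_ge (hmax (j := (A, K)) ⟨hA, hK, hAK, fun hb => not_lt_bot (hb ▸ h1)⟩ h1.le)
  exact hne ((key M hM hlt).trans (key L hL hlt').symm)

theorem Group.exists_normal_of_forall_isNilpotent {G : Type*} [Group G] [Finite G]
    (hGnil : ¬ Group.IsNilpotent G)
    (hsub : ∀ H : Subgroup G, H ≠ ⊤ → Group.IsNilpotent H) :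
    ∃ N : Subgroup G, N.Normal ∧ N ≠ ⊥ ∧ N ≠ ⊤ := by
  by_contra! hsimple'
  have hsimple : ∀ N : Subgroup G, N.Normal → N = ⊥ ∨ N = ⊤ :=
    fun N hN => or_iff_not_imp_left.2 (hsimple' N hN)
  have hnn : ∀ M : Subgroup G, IsCoatom M → ¬ M.Normal := by
    intro M hM hn
    have hp := Subgroup.index_prime_of_isCoatom hM
    rcases hsimple M hn with rfl | rfl
    · rw [Subgroup.index_bot] at hp
      have := Fact.mk hp
      exact hGnil (Group.IsNilpotent.of_isCyclic (isCyclic_of_prime_card (p := Nat.card G) rfl))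
    · exact hM.1 rfl
  have hconj : ∀ (M : Subgroup G) (x : G), IsCoatom M →
      IsCoatom (M.comap (MulAut.conj x).toMonoidHom) := by
    intro M x hM
    exact ((MulAut.conj x).comapSubgroup.isCoatom_iff M).2 hM
  have hTI : ∀ M : Subgroup G, IsCoatom M → ∀ x g, g ≠ 1 → g ∈ M → x * g * x⁻¹ ∈ M → x ∈ M := by
    intro M hM x g hg hgM hx
    have heq : M.comap (MulAut.conj x).toMonoidHom = M := by
      by_contra hne
      have hb := Group.inf_eq_bot_of_isCoatom hsub hsimple (hconj M x hM) hM hne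
      have : g ∈ M.comap (MulAut.conj x).toMonoidHom ⊓ M := ⟨hx, hgM⟩
      rw [hb] at this
      exact hg this
    have hn : Subgroup.normalizer (M : Set G) = M := by
      by_contra hne
      exact hnn M hM (Subgroup.normalizer_eq_top_iff.1
        (hM.2 _ (lt_of_le_of_ne Subgroup.le_normalizer (Ne.symm hne))))
    rw [← hn, Subgroup.mem_normalizer_iff]
    intro h
    conv_lhs => rw [← heq]
    rfl
  have hindex : ∀ M : Subgroup G, IsCoatom M → 1 < M.index ∧ M.index * 2 ≤ Nat.card G := by
    intro M hM
    have h1 : M.index ≠ 1 := fun h1 => hM.1 (Subgroup.index_eq_one.1 h1)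
    have h2 : M.index ≠ 0 := Subgroup.index_ne_zero_of_finite
    refine ⟨by omega, ?_⟩
    have hb : M ≠ ⊥ := fun h => hnn M hM (h ▸ inferInstance)
    rw [← M.card_mul_index, mul_comm]
    exact Nat.mul_le_mul_right _ (Subgroup.one_lt_card_iff_ne_bot M |>.2 hb)
  have hcoatom : ∀ g : G, ∃ M : Subgroup G, IsCoatom M ∧ g ∈ M := by
    intro g
    obtain ⟨M, hM, hle⟩ := (eq_top_or_exists_le_coatom (Subgroup.zpowers g)).resolve_left
      fun h => hGnil (Group.IsNilpotent.of_isCyclic (isCyclic_iff_exists_zpowers_eq_top.2 ⟨g, h⟩))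
    exact ⟨M, hM, hle (Subgroup.mem_zpowers g)⟩
  obtain ⟨M, hM, -⟩ := hcoatom 1
  obtain ⟨g, hg⟩ := Subgroup.exists_not_mem_conj hM.1
  have hg1 : g ≠ 1 := by
    rintro rfl
    exact hg 1 (by simp)
  obtain ⟨L, hL, hgL⟩ := hcoatom g
  have hdisj : Disjoint {g : G | g ≠ 1 ∧ ∃ x, x * g * x⁻¹ ∈ M}
      {g : G | g ≠ 1 ∧ ∃ x, x * g * x⁻¹ ∈ L} := by
    rw [Set.disjoint_left]
    rintro a ⟨ha, x, hx⟩ ⟨-, y, hy⟩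
    have heq : M.comap (MulAut.conj x).toMonoidHom = L.comap (MulAut.conj y).toMonoidHom := by
      by_contra hne
      have hb := Group.inf_eq_bot_of_isCoatom hsub hsimple (hconj M x hM) (hconj L y hL) hne
      have : a ∈ M.comap (MulAut.conj x).toMonoidHom ⊓ L.comap (MulAut.conj y).toMonoidHom :=
        ⟨hx, hy⟩
      rw [hb] at this
      exact ha this
    have hmem : y⁻¹ * g * y ∈ L.comap (MulAut.conj y).toMonoidHom := by
      simpa [mul_assoc] using hgL
    rw [← heq] at hmem
    apply hg (x * y⁻¹)
    simpa [mul_assoc] using hmem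
  have hcard := Set.ncard_union_eq hdisj
  have hle : ({g : G | g ≠ 1 ∧ ∃ x, x * g * x⁻¹ ∈ M} ∪
      {g : G | g ≠ 1 ∧ ∃ x, x * g * x⁻¹ ∈ L}).ncard ≤ ({1}ᶜ : Set G).ncard := by
    refine Set.ncard_le_ncard ?_
    rintro a (ha | ha)
    · exact ha.1
    · exact ha.1
  rw [hcard, Subgroup.ncard_conj_eq (hTI M hM), Subgroup.ncard_conj_eq (hTI L hL),
    Set.ncard_compl, Set.ncard_singleton] at hle
  have h1 := hindex M hM
  have h2 := hindex L hL
  omega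

theorem Group.isSolvable_of_forall_isNilpotent {G : Type*} [Group G] [Finite G]
    (hsub : ∀ H : Subgroup G, H ≠ ⊤ → Group.IsNilpotent H) : IsSolvable G := by
  induction hn : Nat.card G using Nat.strong_induction_on generalizing G with
  | _ n ih =>
    by_cases hG : Group.IsNilpotent G
    · infer_instance
    obtain ⟨N, hN, hbot, htop⟩ := Group.exists_normal_of_forall_isNilpotent hG hsub
    have h1 : IsSolvable N := by
      have := hsub N htop
      infer_instance
    have h2 : IsSolvable (G ⧸ N) := by
      refine ih (Nat.card (G ⧸ N)) ?_ (fun H hH => ?_) rfl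
      · rw [← hn, Subgroup.card_eq_card_quotient_mul_card_subgroup N]
        exact lt_mul_of_one_lt_right Nat.card_pos (Subgroup.one_lt_card_iff_ne_bot N |>.2 hbot)
      · have hc : Group.IsNilpotent (H.comap (QuotientGroup.mk' N)) := by
          refine hsub _ fun h => hH ?_
          rw [← Subgroup.index_eq_one, ← Subgroup.index_comap_of_surjective _
            (QuotientGroup.mk'_surjective N), h, Subgroup.index_top]
        exact Group.nilpotent_of_surjective ((QuotientGroup.mk' N).subgroupComap H)
          ((QuotientGroup.mk' N).subgroupComap_surjective_of_surjective H
            (QuotientGroup.mk'_surjective N))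
    exact Group.isSolvable_of_ker_le_range N.subtype (QuotientGroup.mk' N) (by simp)

theorem IsPGroup.commute_of_le_of_isNilpotent {G : Type*} [Group G] [Finite G] {p q : ℕ}
    [Fact p.Prime] [Fact q.Prime] (hpq : p ≠ q) {A B K : Subgroup G} (hA : IsPGroup p A)
    (hB : IsPGroup q B) (hK : Group.IsNilpotent K) (hAK : A ≤ K) (hBK : B ≤ K) {a b : G}
    (ha : a ∈ A) (hb : b ∈ B) : Commute a b := by
  obtain ⟨P, hP⟩ := (hA.comap_subtype (K := K)).exists_le_sylow
  obtain ⟨Q, hQ⟩ := (hB.comap_subtype (K := K)).exists_le_sylow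
  have h := Subgroup.commute_of_normal_of_disjoint (P : Subgroup K) Q inferInstance inferInstance
    (IsPGroup.disjoint_of_ne p q hpq _ _ P.isPGroup' Q.isPGroup') ⟨a, hAK ha⟩ ⟨b, hBK hb⟩
    (hP ha) (hQ hb)
  exact h.map K.subtype

theorem Sylow.normal_of_isNilpotent_of_ne_index {G : Type*} [Group G] [Finite G] {q r : ℕ}
    [Fact q.Prime] [Fact r.Prime] (hrq : r ≠ q) {N : Subgroup G} [N.Normal]
    (hN : Group.IsNilpotent N) (hNq : N.index = q) (R : Sylow r G) :
    (R : Subgroup G) ≤ N ∧ (R : Subgroup G).Normal := by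
  have hle : (R : Subgroup G) ≤ N := by
    intro x hx
    obtain ⟨k, hk⟩ := R.isPGroup' ⟨x, hx⟩
    have hk : x ^ r ^ k = 1 := congrArg Subtype.val hk
    have hcop : Nat.Coprime (r ^ k) q :=
      Nat.Coprime.pow_left _ ((Nat.coprime_primes Fact.out Fact.out).2 hrq)
    rw [← QuotientGroup.eq_one_iff, ← orderOf_eq_one_iff]
    refine Nat.eq_one_of_dvd_coprimes hcop ?_ ?_
    · rw [orderOf_dvd_iff_pow_eq_one, ← QuotientGroup.mk_pow, hk, QuotientGroup.mk_one]
    · rw [← hNq]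
      exact orderOf_dvd_natCard _
  refine ⟨hle, ?_⟩
  have hn : (R.subtype hle : Subgroup N).Normal := inferInstance
  have := Sylow.characteristic_of_normal (R.subtype hle) hn
  have h : ((R.subtype hle : Subgroup N).map N.subtype).Normal := inferInstance
  rwa [Sylow.coe_subtype, Subgroup.map_subgroupOf_eq_of_le hle] at h

theorem Group.exists_not_normal_sylow_eq_zpowers {G : Type*} [Group G] [Finite G]
    (hGnil : ¬ Group.IsNilpotent G)
    (hsub : ∀ H : Subgroup G, H ≠ ⊤ → Group.IsNilpotent H) :
    ∃ (q : ℕ) (_ : Fact q.Prime) (Q : Sylow q G) (y : G),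
      ¬ (Q : Subgroup G).Normal ∧ Subgroup.zpowers y = Q := by
  have hsol := Group.isSolvable_of_forall_isNilpotent hsub
  have hnt : Nontrivial G := by
    by_contra h
    rw [not_nontrivial_iff_subsingleton] at h
    exact hGnil inferInstance
  obtain ⟨N, hN, hcN⟩ := (eq_top_or_exists_le_coatom (commutator G)).resolve_left
    (IsSolvable.commutator_lt_top_of_nontrivial G).ne
  have hNn : N.Normal := Subgroup.Normal.of_commutator_le G hcN
  obtain ⟨q, hNq⟩ : ∃ q, N.index = q := ⟨_, rfl⟩
  have hq : Fact q.Prime := ⟨hNq ▸ Subgroup.index_prime_of_isCoatom hN⟩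
  have hNnil := hsub N hN.1
  have hR := fun (r : ℕ) (_ : Fact r.Prime) (hrq : r ≠ q) (R : Sylow r G) =>
    R.normal_of_isNilpotent_of_ne_index hrq hNnil hNq
  obtain ⟨Q, hQ⟩ : ∃ Q : Sylow q G, ¬ (Q : Subgroup G).Normal := by
    by_contra! h
    refine hGnil ((Group.isNilpotent_of_finite_tfae.out 0 3 rfl rfl).2 fun r hr R => ?_)
    by_cases hrq : r = q
    · subst hrq
      exact h R
    · exact (hR r hr hrq R).2
  have hQN : ¬ (Q : Subgroup G) ≤ N := by
    intro h
    have hd := Subgroup.index_dvd_of_le h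
    rw [hNq] at hd
    exact Q.not_dvd_index hd
  obtain ⟨y, hyQ, hyN⟩ := SetLike.not_le_iff_exists.1 hQN
  have hyle : Subgroup.zpowers y ≤ Q := Subgroup.zpowers_le.2 hyQ
  refine ⟨q, hq, Q, y, hQ, ?_⟩
  by_contra hyne
  have hsup : ∀ (r : ℕ) (_ : Fact r.Prime), r ≠ q → ∀ R : Sylow r G,
      (R : Subgroup G) ⊔ Subgroup.zpowers y ≠ ⊤ := by
    intro r hr hrq R h
    have := (hR r hr hrq R).2
    have hi := Subgroup.relIndex_sup_left (H := Subgroup.zpowers y) (K := R)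
    rw [h, Subgroup.relIndex_top_right] at hi
    have hd : Nat.card Q ∣ (R : Subgroup G).index := by
      have hcop := IsPGroup.coprime_card_of_ne q r hrq.symm _ _ Q.isPGroup' R.isPGroup'
      refine hcop.dvd_of_dvd_mul_left ?_
      rw [Subgroup.card_mul_index]
      exact Subgroup.card_subgroup_dvd_card _
    rw [hi] at hd
    exact hyne (Subgroup.eq_of_le_of_card_ge hyle
      (Nat.le_of_dvd Nat.card_pos (hd.trans (Subgroup.relIndex_dvd_card _ _))))
  have hcomm : ∀ (r : ℕ) (_ : Fact r.Prime), r ≠ q → ∀ R : Sylow r G, ∀ a ∈ R, ∀ b ∈ Q,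
      Commute a b := by
    intro r hr hrq R a ha b hb
    have hay : Commute a y := IsPGroup.commute_of_le_of_isNilpotent hrq R.isPGroup'
      (Q.isPGroup'.to_le hyle) (hsub _ (hsup r hr hrq R)) le_sup_left le_sup_right ha
      (Subgroup.mem_zpowers y)
    have hmem : (b : G ⧸ N) ∈ Subgroup.zpowers (y : G ⧸ N) :=
      mem_zpowers_of_prime_card (p := q) hNq (by rwa [Ne, QuotientGroup.eq_one_iff])
    obtain ⟨i, hi⟩ := Subgroup.mem_zpowers_iff.1 hmem
    have hcN : (y ^ i)⁻¹ * b ∈ N := QuotientGroup.eq.1 hi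
    have hcQ : (y ^ i)⁻¹ * b ∈ (Q : Subgroup G) := mul_mem (inv_mem (zpow_mem hyQ i)) hb
    have hac : Commute a ((y ^ i)⁻¹ * b) := IsPGroup.commute_of_le_of_isNilpotent hrq R.isPGroup'
      (Q.isPGroup'.to_le (inf_le_left (b := N))) hNnil (hR r hr hrq R).1 inf_le_right ha
      ⟨hcQ, hcN⟩
    simpa using (hay.zpow_right i).mul_right hac
  refine hQ (Subgroup.normalizer_eq_top_iff.1 ?_)
  rw [← Subgroup.index_eq_one]
  by_contra hne
  obtain ⟨r, hr, hrd⟩ := Nat.exists_prime_and_dvd hne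
  have := Fact.mk hr
  by_cases hrq : r = q
  · subst hrq
    exact Q.not_dvd_index (hrd.trans (Subgroup.index_dvd_of_le Subgroup.le_normalizer))
  · let R : Sylow r G := default
    refine R.not_dvd_index (hrd.trans (Subgroup.index_dvd_of_le fun a ha => ?_))
    refine Subgroup.centralizer_le_normalizer _ (Subgroup.mem_centralizer_iff.2 fun b hb => ?_)
    exact (hcomm r this hrq R a ha b hb).eq.symm

theorem Sylow.normalizer_eq_top_of_isESPartition {G : Type*} [Group G] [Finite G] {q : ℕ}
    [Fact q.Prime] (Q : Sylow q G) {S H : Subgroup G} {P : Finset (Subgroup G)}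
    (hP : IsESPartition S P) (hnil : ∀ K ∈ P, Group.IsNilpotent K) (hH : H ∈ P)
    (hQH : (Q : Subgroup G) ≤ H) : Subgroup.normalizer (Q : Set G) = ⊤ := by
  by_contra hne
  obtain ⟨g, hg⟩ := Subgroup.exists_not_mem_conj hne
  obtain ⟨K, hK, hgK⟩ := hP.1.2.2.1 g
  have := hnil K hK
  let QK : Sylow q K := default
  obtain ⟨Q', hQ'⟩ := (QK.isPGroup'.map K.subtype).exists_le_sylow
  have hcard : Nat.card Q' ≤ Nat.card ((QK : Subgroup K).map K.subtype) := by
    rw [Subgroup.card_map_of_injective K.subtype_injective]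
    refine Nat.le_of_dvd Nat.card_pos ?_
    rw [Q'.card_eq_multiplicity]
    refine QK.pow_dvd_card_of_pow_dvd_card ?_
    rw [← Q.card_eq_multiplicity, ← hP.2 H hH K hK]
    exact Subgroup.card_dvd_of_le hQH
  have hQ'K : (Q' : Subgroup G) ≤ K := by
    rw [← Subgroup.eq_of_le_of_card_ge hQ' hcard]
    exact Subgroup.map_subtype_le _
  have hgQ' : g • Q' = Q' := by
    have h := Sylow.smul_subtype hQ'K ⟨g, hgK⟩
    rw [Sylow.smul_eq_of_normal] at h
    exact (Sylow.subtype_injective h).symm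
  obtain ⟨x, rfl⟩ := MulAction.exists_smul_eq G Q Q'
  refine hg x⁻¹ ?_
  rw [inv_inv, ← Sylow.smul_eq_iff_mem_normalizer, mul_smul, mul_smul, hgQ', inv_smul_smul]

theorem minimal_non_ESPartition_of_schmidt {G : Type*} [Group G] [Finite G]
    (hGnil : ¬ Group.IsNilpotent G)
    (hsub : ∀ H : Subgroup G, H ≠ ⊤ → Group.IsNilpotent H) :
    (∀ (S : Subgroup G) (P : Finset (Subgroup G)), ¬ IsESPartition S P) ∧
    (∀ H : Subgroup G, H ≠ ⊤ → ¬ IsCyclic H →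
      ∃ (T : Subgroup H) (P : Finset (Subgroup H)), IsESPartition T P) := by
  refine ⟨fun S P hP => ?_, fun H hH hcyc => (hsub H hH).exists_isESPartition hcyc⟩
  obtain ⟨q, _, Q, y, hQ, hy⟩ := Group.exists_not_normal_sylow_eq_zpowers hGnil hsub
  obtain ⟨H, hH, hyH⟩ := hP.1.2.2.1 y
  exact hQ (Subgroup.normalizer_eq_top_iff.1 (Q.normalizer_eq_top_of_isESPartition hP
    (fun K hK => hsub K (hP.1.2.1 K hK)) hH (hy ▸ Subgroup.zpowers_le.2 hyH)))
end
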